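/- arXiv:1512.03282 — 2 statements merged into one kernel-verified Lean document; each statement's English description precedes it below -/
import Mathlib

section
/- There exist universal constants c, C, c1, c2, C3 > 0 such that the following holds. Let n ≥ 1, let t0 ≥ 5·√(log n), let X be a random vector in ℝ^n with P(X = 0) = 0 satisfying E⟨X/|X|, θ⟩² ≤ 5/n for all θ ∈ S^{n-1}, let M > 0 satisfy P(|X| ≥ M) ≥ 1/3 and P(|X| ≤ M) ≥ 2/3, and let θ1, θ2 ∈ S^{n-1} be unit vectors such that for every v ∈ S^{n-1} with |⟨v, θ1⟩| ≤ 1/10 one has P(|X| ≥ M and |X/|X| − v| ≤ 1/5) ≤ 2·e^{−t0²}. Then there exists a fixed subset F ⊆ S^{n-1} with σ_{n-1}(F) ≥ 1 − C/n^c such that for every θ3 ∈ F, setting θ = (θ1 − θ2 + θ3)/|θ1 − θ2 + θ3|, for all t ∈ [√(log n), t0]: min{ P(⟨X, θ⟩ ≥ c1·(M/√n)·t), P(⟨X, θ⟩ ≤ −c1·(M/√n)·t) } ≥ c2·e^{−C3·t²}. -/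
open MeasureTheory Metric
open scoped ENNReal RealInnerProductSpace

noncomputable section

/-- The uniform (rotation-invariant) probability measure on the unit sphere
`S^{n-1} ⊆ ℝⁿ`, obtained by normalizing the surface measure. -/
def sphereMeasure (n : ℕ) : Measure (sphere (0 : EuclideanSpace ℝ (Fin n)) 1) :=
  (((volume : Measure (EuclideanSpace ℝ (Fin n))).toSphere Set.univ)⁻¹) •
    (volume : Measure (EuclideanSpace ℝ (Fin n))).toSphere

/-- The density of the standard Gaussian measure on a Euclidean space. -/
def stdGaussianDensity (V : Type*) [NormedAddCommGroup V] [InnerProductSpace ℝ V] (g : V) : ℝ :=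
  (2 * Real.pi) ^ (-(Module.finrank ℝ V / 2 : ℝ)) * Real.exp (-(1 / 2) * ‖g‖ ^ 2)

lemma stdGaussianDensity_nonneg {V : Type*} [NormedAddCommGroup V] [InnerProductSpace ℝ V] 
    (g : V) : 0 ≤ stdGaussianDensity V g := by
  unfold stdGaussianDensity; positivity

lemma measurable_stdGaussianDensity {V : Type*} [NormedAddCommGroup V] [InnerProductSpace ℝ V] 
    [MeasurableSpace V] [BorelSpace V] :
    Measurable fun g : V ↦ ENNReal.ofReal (stdGaussianDensity V g) := by
  unfold stdGaussianDensity; fun_prop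

section StandardGaussian

variable {V : Type*} [NormedAddCommGroup V] [InnerProductSpace ℝ V] [FiniteDimensional ℝ V]
  [MeasurableSpace V] [BorelSpace V]

/-- The standard Gaussian measure on a Euclidean space, given by its density. -/
def stdGaussianMeasure (V : Type*) [NormedAddCommGroup V] [InnerProductSpace ℝ V]
    [FiniteDimensional ℝ V] [MeasurableSpace V] [BorelSpace V] : Measure V :=
  volume.withDensity fun g ↦ ENNReal.ofReal (stdGaussianDensity V g)

lemma lintegral_exp_neg_mul_sq_norm {b : ℝ} (hb : 0 < b) :
    ∫⁻ g : V, ENNReal.ofReal (Real.exp (-b * ‖g‖ ^ 2)) =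
      ENNReal.ofReal ((Real.pi / b) ^ (Module.finrank ℝ V / 2 : ℝ)) := by
  rw [← GaussianFourier.integral_rexp_neg_mul_sq_norm hb, ofReal_integral_eq_lintegral_ofReal]
  · have h := GaussianFourier.integrable_cexp_neg_mul_sq_norm_add (V := V)
      (b := (b : ℂ)) (by simpa using hb) 0 0
    convert h.norm using 2 with g
    simp [Complex.norm_exp, ← Complex.ofReal_pow]
  · exact Filter.Eventually.of_forall fun g ↦ (Real.exp_pos _).le

/-- Exponential moments of the squared norm under the standard Gaussian measure. -/
lemma lintegral_exp_sq_norm_stdGaussianMeasure {a : ℝ} (ha : a < 1 / 2) :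
    ∫⁻ g : V, ENNReal.ofReal (Real.exp (a * ‖g‖ ^ 2)) ∂stdGaussianMeasure V =
      ENNReal.ofReal ((1 - 2 * a)⁻¹ ^ (Module.finrank ℝ V / 2 : ℝ)) := by
  have ha' : 0 < 1 / 2 - a := by linarith
  rw [stdGaussianMeasure, lintegral_withDensity_eq_lintegral_mul _ measurable_stdGaussianDensity
    (by fun_prop)]
  have h : ∀ g : V, ((fun g : V ↦ ENNReal.ofReal (stdGaussianDensity V g)) *
      fun g : V ↦ ENNReal.ofReal (Real.exp (a * ‖g‖ ^ 2))) g =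
      ENNReal.ofReal ((2 * Real.pi) ^ (-(Module.finrank ℝ V / 2 : ℝ))) *
        ENNReal.ofReal (Real.exp (-(1 / 2 - a) * ‖g‖ ^ 2)) := by
    intro g
    rw [Pi.mul_apply, ← ENNReal.ofReal_mul (stdGaussianDensity_nonneg g),
      ← ENNReal.ofReal_mul (by positivity), stdGaussianDensity, mul_assoc, ← Real.exp_add]
    ring_nf
  rw [lintegral_congr h, lintegral_const_mul _ (by fun_prop), lintegral_exp_neg_mul_sq_norm ha',
    ← ENNReal.ofReal_mul (by positivity), Real.rpow_neg (by positivity),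
    ← Real.inv_rpow (by positivity), ← Real.mul_rpow (by positivity) (by positivity)]
  have : 1 - 2 * a ≠ 0 := by linarith
  have h3 : 1 / 2 - a ≠ 0 := ha'.ne'
  congr 2
  have := Real.pi_pos.ne'
  rw [inv_mul_eq_div, div_div, eq_comm, inv_eq_one_div, div_eq_div_iff (by assumption) (by positivity)]
  ring

instance : IsProbabilityMeasure (stdGaussianMeasure V) where
  measure_univ := by
    simpa using lintegral_exp_sq_norm_stdGaussianMeasure (V := V) (a := 0) (by norm_num)

/-- The Cameron–Martin formula for the standard Gaussian measure. -/
lemma lintegral_stdGaussianMeasure_eq_shift {h : V → ℝ≥0∞} (hh : Measurable h) (v : V) :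
    ∫⁻ g, h g ∂stdGaussianMeasure V =
      ∫⁻ g, h (g + v) * ENNReal.ofReal (Real.exp (-⟪v, g⟫ - ‖v‖ ^ 2 / 2))
        ∂stdGaussianMeasure V := by
  rw [stdGaussianMeasure, lintegral_withDensity_eq_lintegral_mul _ measurable_stdGaussianDensity hh,
    lintegral_withDensity_eq_lintegral_mul _ measurable_stdGaussianDensity (by fun_prop),
    ← lintegral_add_right_eq_self _ v]
  refine lintegral_congr fun g ↦ ?_
  simp only [Pi.mul_apply]
  rw [mul_comm (h _), ← mul_assoc, ← ENNReal.ofReal_mul (stdGaussianDensity_nonneg g)]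
  congr 2
  rw [stdGaussianDensity, stdGaussianDensity, mul_assoc, ← Real.exp_add,
    norm_add_sq_real, real_inner_comm]
  ring_nf

/-- The Gaussian tail bound for a half-space. -/
lemma stdGaussianMeasure_inner_lt_le {u : V} (hu : ‖u‖ = 1) {r : ℝ} (hr : 0 ≤ r) :
    stdGaussianMeasure V {g | ⟪u, g⟫ < -r} ≤ ENNReal.ofReal (Real.exp (-r ^ 2 / 2)) := by
  have h1 := lintegral_stdGaussianMeasure_eq_shift (V := V) (h := fun _ ↦ 1) measurable_const
    (r • u)
  simp only [lintegral_one, measure_univ, one_mul] at h1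
  have hle : ENNReal.ofReal (Real.exp (r ^ 2 / 2)) * stdGaussianMeasure V {g | ⟪u, g⟫ < -r} ≤ 1 := by
    rw [h1]
    refine le_trans (mul_le_mul_right ?_ _) (mul_meas_ge_le_lintegral (by fun_prop) _)
    refine measure_mono fun g hg ↦ ?_
    simp only [Set.mem_ofPred_eq, real_inner_smul_left, norm_smul, hu] at hg ⊢
    refine ENNReal.ofReal_le_ofReal (Real.exp_le_exp.2 ?_)
    rw [mul_one, Real.norm_eq_abs, sq_abs]
    nlinarith
  rw [neg_div, Real.exp_neg, ENNReal.ofReal_inv_of_pos (Real.exp_pos _)]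
  exact ENNReal.le_inv_iff_mul_le.2 (by rwa [mul_comm])

/-- At least a quarter of the standard Gaussian mass lies within distance `2√(dim V)` of the origin. -/
lemma quarter_le_stdGaussianMeasure_norm_le [Nontrivial V] :
    (1 / 4 : ℝ≥0∞) ≤
      stdGaussianMeasure V {g | ‖g‖ ≤ 2 * Real.sqrt (Module.finrank ℝ V)} := by
  set d := Module.finrank ℝ V with hd
  have hd1 : (1 : ℝ) ≤ d := by exact_mod_cast Module.finrank_pos (R := ℝ) (M := V)
  have hS : MeasurableSet {g : V | ‖g‖ ≤ 2 * Real.sqrt d} :=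
    measurableSet_le measurable_norm measurable_const
  have hle : ENNReal.ofReal (Real.exp d) *
      stdGaussianMeasure V {g | ‖g‖ ≤ 2 * Real.sqrt d}ᶜ ≤ ENNReal.ofReal (Real.exp (d / 2)) := by
    have h2 := lintegral_exp_sq_norm_stdGaussianMeasure (V := V) (a := 1 / 4) (by norm_num)
    refine le_trans (le_trans (mul_le_mul_right (measure_mono fun g hg ↦ ?_) _)
      (mul_meas_ge_le_lintegral (f := fun g : V ↦ ENNReal.ofReal (Real.exp (1 / 4 * ‖g‖ ^ 2)))
        (by fun_prop) _)) ?_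
    · simp only [Set.mem_compl_iff, Set.mem_ofPred_eq, not_le] at hg ⊢
      refine ENNReal.ofReal_le_ofReal (Real.exp_le_exp.2 ?_)
      have := Real.sq_sqrt (show (0 : ℝ) ≤ d by positivity)
      nlinarith [Real.sqrt_nonneg (d : ℝ)]
    · rw [h2]
      refine ENNReal.ofReal_le_ofReal ?_
      rw [show (d : ℝ) / 2 = 1 * (d / 2) by ring, Real.exp_mul, one_mul]
      refine Real.rpow_le_rpow (by norm_num) ?_ (by positivity)
      have := Real.add_one_le_exp 1
      norm_num at this ⊢
      linarith
  have hc : stdGaussianMeasure V {g | ‖g‖ ≤ 2 * Real.sqrt d}ᶜ ≤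
      ENNReal.ofReal (Real.exp (-(d / 2))) := by
    have he : (0 : ℝ) < Real.exp d := Real.exp_pos _
    rw [show -((d : ℝ) / 2) = d / 2 - d by ring, Real.exp_sub, ENNReal.ofReal_div_of_pos he]
    refine ENNReal.le_div_iff_mul_le (by simp [he]) (by simp) |>.2 (by rwa [mul_comm])
  have hexp : Real.exp (-((d : ℝ) / 2)) ≤ 3 / 4 := by
    rw [Real.exp_neg]
    have := Real.add_one_le_exp ((d : ℝ) / 2)
    exact inv_le_of_inv_le₀ (by norm_num) (by linarith)
  have hc' := hc.trans (ENNReal.ofReal_le_ofReal hexp)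
  rw [← ofReal_measureReal, ENNReal.ofReal_le_ofReal_iff (by norm_num),
    probReal_compl_eq_one_sub hS] at hc'
  rw [← ofReal_measureReal, show (1 / 4 : ℝ≥0∞) = ENNReal.ofReal (1 / 4) by
    rw [ENNReal.ofReal_div_of_pos (by norm_num)]; simp]
  exact ENNReal.ofReal_le_ofReal (by linarith)

end StandardGaussian

section PolarCoordinates

variable {V : Type*} [NormedAddCommGroup V] [InnerProductSpace ℝ V] [FiniteDimensional ℝ V]
  [MeasurableSpace V] [BorelSpace V]

/-- Integration in polar coordinates. -/
lemma lintegral_volume_eq_lintegral_toSphere_prod [Nontrivial V] (h : V → ℝ≥0∞) :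
    ∫⁻ x : V, h x =
      ∫⁻ p : sphere (0 : V) 1 × Set.Ioi (0 : ℝ), h ((p.2 : ℝ) • (p.1 : V))
        ∂((volume : Measure V).toSphere.prod
          (Measure.volumeIoiPow (Module.finrank ℝ V - 1))) := by
  have mp := ((volume : Measure V).measurePreserving_homeomorphUnitSphereProd).symm
    (homeomorphUnitSphereProd V).toMeasurableEquiv
  have h1 : ∫⁻ x : V, h x = ∫⁻ x : ({0}ᶜ : Set V), h x ∂(volume : Measure V).comap (↑) := by
    rw [lintegral_subtype_comap (measurableSet_singleton _).compl, restrict_compl_singleton]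
  rw [h1, ← mp.lintegral_comp_emb (homeomorphUnitSphereProd V).symm.measurableEmbedding]
  rfl

/-- A set of directions has spherical measure controlled by the Gaussian measure of the
corresponding truncated cone. -/
lemma toSphere_mul_stdGaussianMeasure_le [Nontrivial V] {B : Set (sphere (0 : V) 1)}
    (hB : MeasurableSet B) {K : Set V} (hK : MeasurableSet K) {R : ℝ}
    (hBK : ∀ θ ∈ B, ∀ r : ℝ, 0 < r → r ≤ R → r • (θ : V) ∈ K) :
    (volume : Measure V).toSphere B * stdGaussianMeasure V {g | ‖g‖ ≤ R} ≤
      (volume : Measure V).toSphere Set.univ * stdGaussianMeasure V K := by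
  set T := (volume : Measure V).toSphere
  set m := Measure.volumeIoiPow (Module.finrank ℝ V - 1)
  let D : Set.Ioi (0 : ℝ) → ℝ≥0∞ := fun r ↦ {r : Set.Ioi (0 : ℝ) | (r : ℝ) ≤ R}.indicator
    (fun r ↦ ENNReal.ofReal ((2 * Real.pi) ^ (-(Module.finrank ℝ V / 2 : ℝ)) *
      Real.exp (-(1 / 2) * (r : ℝ) ^ 2))) r
  have hD : Measurable D :=
    Measurable.indicator (by fun_prop) (measurableSet_le measurable_subtype_coe measurable_const)
  have hnorm : ∀ p : sphere (0 : V) 1 × Set.Ioi (0 : ℝ), ‖(p.2 : ℝ) • (p.1 : V)‖ = p.2 := by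
    intro p
    have := p.2.2
    rw [norm_smul, norm_eq_of_mem_sphere, mul_one, Real.norm_of_nonneg (le_of_lt this)]
  have hball : stdGaussianMeasure V {g | ‖g‖ ≤ R} = T Set.univ * ∫⁻ r, D r ∂m := by
    have hS : MeasurableSet {g : V | ‖g‖ ≤ R} := measurableSet_le measurable_norm measurable_const
    rw [stdGaussianMeasure, withDensity_apply _ hS, ← lintegral_indicator hS,
      lintegral_volume_eq_lintegral_toSphere_prod]
    have : ∀ p : sphere (0 : V) 1 × Set.Ioi (0 : ℝ),
        {g : V | ‖g‖ ≤ R}.indicator (fun g ↦ ENNReal.ofReal (stdGaussianDensity V g))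
          ((p.2 : ℝ) • (p.1 : V)) = 1 * D p.2 := by
      intro p
      simp only [Set.indicator, Set.mem_ofPred_eq, hnorm, stdGaussianDensity, D, one_mul]
    rw [lintegral_congr this, lintegral_prod_mul (f := fun _ ↦ 1) (by fun_prop) hD.aemeasurable,
      lintegral_one]
  have hcone : T B * ∫⁻ r, D r ∂m ≤ stdGaussianMeasure V K := by
    rw [stdGaussianMeasure, withDensity_apply _ hK, ← lintegral_indicator hK,
      lintegral_volume_eq_lintegral_toSphere_prod, ← lintegral_indicator_one hB,
      ← lintegral_prod_mul ((measurable_one.indicator hB).aemeasurable) hD.aemeasurable]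
    refine lintegral_mono fun p ↦ ?_
    by_cases h1 : p.1 ∈ B
    · by_cases h2 : (p.2 : ℝ) ≤ R
      · have hp : (p.2 : ℝ) • (p.1 : V) ∈ K := hBK p.1 h1 p.2 p.2.2 h2
        simp [Set.indicator, h1, h2, hp, D, stdGaussianDensity, hnorm]
      · simp [D, Set.indicator, h2]
    · simp [h1]
  rw [hball, mul_left_comm]
  gcongr

end PolarCoordinates

/-- Comparison of the uniform measure on the sphere with the Gaussian measure of a cone. -/
lemma sphereMeasure_le_four_mul_stdGaussianMeasure {n : ℕ} (hn : 1 ≤ n)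
    {B : Set (sphere (0 : EuclideanSpace ℝ (Fin n)) 1)} (hB : MeasurableSet B)
    {K : Set (EuclideanSpace ℝ (Fin n))} (hK : MeasurableSet K)
    (hBK : ∀ θ ∈ B, ∀ r : ℝ, 0 < r → r ≤ 2 * Real.sqrt n →
      r • (θ : EuclideanSpace ℝ (Fin n)) ∈ K) :
    sphereMeasure n B ≤ 4 * stdGaussianMeasure (EuclideanSpace ℝ (Fin n)) K := by
  have : Nonempty (Fin n) := ⟨⟨0, hn⟩⟩
  have h1 := toSphere_mul_stdGaussianMeasure_le hB hK hBK
  have h2 := quarter_le_stdGaussianMeasure_norm_le (V := EuclideanSpace ℝ (Fin n))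
  rw [finrank_euclideanSpace_fin] at h2
  have hT0 := (Measure.measure_univ_ne_zero (μ :=
    (volume : Measure (EuclideanSpace ℝ (Fin n))).toSphere)).2 (Measure.toSphere_ne_zero _)
  have hT := measure_ne_top (volume : Measure (EuclideanSpace ℝ (Fin n))).toSphere Set.univ
  rw [sphereMeasure, Measure.smul_apply, smul_eq_mul, mul_comm, ← div_eq_mul_inv]
  refine ENNReal.div_le_of_le_mul' ?_
  have h3 : (volume : Measure (EuclideanSpace ℝ (Fin n))).toSphere B =
      4 * ((volume : Measure (EuclideanSpace ℝ (Fin n))).toSphere B * (1 / 4)) := by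
    rw [mul_left_comm, mul_one_div, ENNReal.div_self (by norm_num) (by norm_num), mul_one]
  rw [h3, mul_left_comm (Measure.toSphere _ Set.univ)]
  exact mul_le_mul_right (le_trans (mul_le_mul_right h2 _) h1) _

lemma isProbabilityMeasure_sphereMeasure {n : ℕ} (hn : 1 ≤ n) :
    IsProbabilityMeasure (sphereMeasure n) := by
  have : Nonempty (Fin n) := ⟨⟨0, hn⟩⟩
  have hT0 := (Measure.measure_univ_ne_zero (μ :=
    (volume : Measure (EuclideanSpace ℝ (Fin n))).toSphere)).2 (Measure.toSphere_ne_zero _)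
  exact ⟨ENNReal.inv_mul_cancel hT0 (measure_ne_top _ _)⟩

section SudakovMinoration

variable {V : Type*} [NormedAddCommGroup V] [InnerProductSpace ℝ V]

lemma norm_sub_le_of_inner_shift_le {u u' y : V} {t : ℝ} (ht : 0 < t)
    (h1 : -(t / 250) ≤ ⟪u, y - (t / 2) • u⟫) (h2 : -(t / 250) ≤ ⟪u', y - (t / 2) • u'⟫)
    (h3 : ⟪u, y - (t / 2) • u'⟫ ≤ t / 250) (h4 : ⟪u', y - (t / 2) • u⟫ ≤ t / 250) :
    ‖u' - u‖ ≤ 1 / 5 := by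
  have h : t / 2 * ‖u' - u‖ ^ 2 =
      ⟪u, y - (t / 2) • u'⟫ - ⟪u, y - (t / 2) • u⟫ - ⟪u', y - (t / 2) • u'⟫
        + ⟪u', y - (t / 2) • u⟫ := by
    rw [norm_sub_sq_real]
    simp only [inner_sub_right, real_inner_smul_right, real_inner_self_eq_norm_sq,
      real_inner_comm u u']
    ring
  have h5 : ‖u' - u‖ ^ 2 ≤ (1 / 5) ^ 2 := by
    by_contra! hc
    nlinarith
  exact le_of_sq_le_sq h5 (by norm_num)

variable [FiniteDimensional ℝ V] [MeasurableSpace V] [BorelSpace V]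
  {Ω : Type*} [MeasurableSpace Ω] {μ : Measure Ω} [IsFiniteMeasure μ] {u : Ω → V}

/-- A set of directions whose shifted points see almost all directions in a thin half-space has
small measure, as soon as small balls of directions have small measure. -/
lemma measure_le_of_shift_mem (hu : Measurable u) {t : ℝ} (ht : 0 < t) {δ η : ℝ≥0∞} (y : V)
    {U : Set Ω} (hU : MeasurableSet U)
    (hball : ∀ ω ∈ U, μ {ω' | ‖u ω' - u ω‖ ≤ 1 / 5} ≤ η)
    (hfew : ∀ ω ∈ U, μ {ω' | t / 250 < ⟪u ω', y - (t / 2) • u ω⟫} ≤ δ)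
    (hlow : ∀ ω ∈ U, -(t / 250) ≤ ⟪u ω, y - (t / 2) • u ω⟫) :
    μ U ≤ δ + δ + η := by
  rcases eq_or_ne (μ U) 0 with h0 | h0
  · simp [h0]
  let A : Set (Ω × Ω) := {p | t / 250 < ⟪u p.2, y - (t / 2) • u p.1⟫}
  let B : Set (Ω × Ω) := {p | ‖u p.2 - u p.1‖ ≤ 1 / 5}
  have hA : MeasurableSet A := measurableSet_lt measurable_const (by fun_prop)
  have hB : MeasurableSet B := measurableSet_le (by fun_prop) measurable_const
  have bound : ∀ (S : Set (Ω × Ω)) (ε : ℝ≥0∞), MeasurableSet S →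
      (∀ ω ∈ U, μ (Prod.mk ω ⁻¹' S) ≤ ε) → (μ.prod μ) ((U ×ˢ Set.univ) ∩ S) ≤ ε * μ U := by
    intro S ε hS h
    rw [Measure.prod_apply ((hU.prod .univ).inter hS), ← setLIntegral_const,
      ← lintegral_indicator hU]
    refine lintegral_mono fun ω ↦ ?_
    by_cases hω : ω ∈ U
    · simp only [hω, Set.indicator_of_mem]
      exact (measure_mono fun ω' h' ↦ h'.2).trans (h ω hω)
    · have : Prod.mk ω ⁻¹' ((U ×ˢ Set.univ) ∩ S) = ∅ := by
        ext ω'; simp [hω]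
      simp [this]
  have hsub : U ×ˢ U ⊆ ((U ×ˢ Set.univ) ∩ A ∪ Prod.swap ⁻¹' ((U ×ˢ Set.univ) ∩ A)) ∪
      (U ×ˢ Set.univ) ∩ B := by
    rintro ⟨ω, ω'⟩ ⟨h1, h2⟩
    by_cases h3 : (ω, ω') ∈ A
    · exact .inl (.inl ⟨⟨h1, trivial⟩, h3⟩)
    by_cases h4 : (ω', ω) ∈ A
    · exact .inl (.inr ⟨⟨h2, trivial⟩, h4⟩)
    exact .inr ⟨⟨h1, trivial⟩, norm_sub_le_of_inner_shift_le ht (hlow ω h1) (hlow ω' h2)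
      (not_lt.1 h4) (not_lt.1 h3)⟩
  have hswap : (μ.prod μ) (Prod.swap ⁻¹' ((U ×ˢ Set.univ) ∩ A)) =
      (μ.prod μ) ((U ×ˢ Set.univ) ∩ A) :=
    Measure.measurePreserving_swap.measure_preimage
      (((hU.prod .univ).inter hA).nullMeasurableSet)
  have hsq : μ U * μ U ≤ (δ + δ + η) * μ U := by
    rw [← Measure.prod_prod, add_mul, add_mul]
    refine (measure_mono hsub).trans ((measure_union_le _ _).trans
      (add_le_add ((measure_union_le _ _).trans (add_le_add ?_ ?_)) ?_))
    · exact bound A δ hA hfew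
    · rw [hswap]; exact bound A δ hA hfew
    · exact bound B η hB hball
  exact (ENNReal.mul_le_mul_iff_left h0 (measure_ne_top _ _)).1 hsq

/-- A high-probability Sudakov minoration: if the directions `u` are unit vectors such that small
balls of directions have measure at most `2 exp (-t ^ 2)`, then for most Gaussian vectors `g`
the event `t / 250 < ⟪u, g⟫` has measure at least `exp (-t ^ 2)`. -/
lemma stdGaussianMeasure_measure_inner_lt_le (hu : Measurable u) {t : ℝ} (ht : 3 ≤ t)
    {G : Set Ω} (hG : MeasurableSet G) (hGc : μ Gᶜ = 0) (hnorm : ∀ ω ∈ G, ‖u ω‖ = 1)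
    (hball : ∀ ω ∈ G, μ {ω' | ‖u ω' - u ω‖ ≤ 1 / 5} ≤
      ENNReal.ofReal (2 * Real.exp (-t ^ 2)))
    (hm : (1 / 4 : ℝ≥0∞) ≤ μ Set.univ) (hm1 : μ Set.univ ≤ 1) :
    stdGaussianMeasure V
        {g | μ {ω | t / 250 < ⟪u ω, g⟫} < ENNReal.ofReal (Real.exp (-t ^ 2))} ≤
      ENNReal.ofReal (40 * Real.exp (-t ^ 2 / 125000)) := by
  have ht0 : 0 < t := by linarith
  set γ := stdGaussianMeasure V
  set δ := ENNReal.ofReal (Real.exp (-t ^ 2))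
  set K := {g : V | μ {ω | t / 250 < ⟪u ω, g⟫} < δ}
  have hA : MeasurableSet {p : V × Ω | t / 250 < ⟪u p.2, p.1⟫} :=
    measurableSet_lt measurable_const (by fun_prop)
  have hA' : MeasurableSet {p : V × Ω | ⟪u p.2, p.1⟫ < -(t / 250)} :=
    measurableSet_lt (by fun_prop) measurable_const
  have hK : MeasurableSet K :=
    measurableSet_lt (measurable_measure_prodMk_left hA) measurable_const
  let W₀ : Set (V × Ω) := {p | p.2 ∈ G ∧ p.1 ∈ K ∧ -(t / 250) ≤ ⟪u p.2, p.1⟫ ∧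
    ⟪u p.2, p.1⟫ ≤ t / 250}
  have hW₀ : MeasurableSet W₀ :=
    (measurable_snd hG).inter ((measurable_fst hK).inter
      ((measurableSet_le (f := fun _ ↦ -(t / 250)) (g := fun p : V × Ω ↦ ⟪u p.2, p.1⟫)
        measurable_const (by fun_prop)).inter
        (measurableSet_le (f := fun p : V × Ω ↦ ⟪u p.2, p.1⟫) (g := fun _ ↦ t / 250)
          (by fun_prop) measurable_const)))
  let W : Set (V × Ω) := (fun p : V × Ω ↦ (p.1 - (t / 2) • u p.2, p.2)) ⁻¹' W₀
  have hW : MeasurableSet W :=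
    (show Measurable fun p : V × Ω ↦ (p.1 - (t / 2) • u p.2, p.2) by fun_prop) hW₀
  have hupper : (γ.prod μ) W ≤ ENNReal.ofReal (4 * Real.exp (-t ^ 2)) := by
    rw [Measure.prod_apply hW]
    refine (lintegral_mono (g := fun _ ↦ ENNReal.ofReal (4 * Real.exp (-t ^ 2)))
      fun y ↦ ?_).trans (by simp [γ])
    have h := measure_le_of_shift_mem (μ := μ) hu ht0 y (measurable_prodMk_left (x := y) hW)
      (fun ω hω ↦ hball ω hω.1) (fun ω hω ↦ le_of_lt hω.2.1) (fun ω hω ↦ hω.2.2.1)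
    refine h.trans_eq ?_
    rw [← ENNReal.ofReal_add (by positivity) (by positivity),
      ← ENNReal.ofReal_add (by positivity) (by positivity)]
    ring_nf
  have hshift : (γ.prod μ) W₀ * ENNReal.ofReal (Real.exp (-t ^ 2 / 2)) ≤ (γ.prod μ) W := by
    rw [Measure.prod_apply_symm hW, Measure.prod_apply_symm hW₀,
      ← lintegral_mul_const _ (measurable_measure_prodMk_right hW₀)]
    refine lintegral_mono fun ω ↦ ?_
    by_cases hω : ω ∈ G
    swap
    · have : (fun x ↦ (x, ω)) ⁻¹' W₀ = ∅ := by ext; simp [W₀, hω]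
      simp [this]
    have hWω : MeasurableSet ((fun x ↦ (x, ω)) ⁻¹' W) := measurable_prodMk_right hW
    have hW₀ω : MeasurableSet ((fun x ↦ (x, ω)) ⁻¹' W₀) := measurable_prodMk_right hW₀
    have h1 := lintegral_stdGaussianMeasure_eq_shift (V := V)
      (h := ((fun x ↦ (x, ω)) ⁻¹' W).indicator 1) (measurable_one.indicator hWω) ((t / 2) • u ω)
    rw [lintegral_indicator_one hWω] at h1
    rw [h1, mul_comm, ← setLIntegral_const, ← lintegral_indicator hW₀ω]
    refine lintegral_mono fun g ↦ ?_
    by_cases hg : g ∈ (fun x ↦ (x, ω)) ⁻¹' W₀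
    swap
    · simp [hg]
    have hg' : g + (t / 2) • u ω ∈ (fun x ↦ (x, ω)) ⁻¹' W := by
      simpa [W] using hg
    rw [Set.indicator_of_mem hg, Set.indicator_of_mem hg', Pi.one_apply, one_mul]
    refine ENNReal.ofReal_le_ofReal (Real.exp_le_exp.2 ?_)
    have h2 : ⟪u ω, g⟫ ≤ t / 250 := hg.2.2.2
    rw [real_inner_smul_left, norm_smul, hnorm ω hω, mul_one, Real.norm_eq_abs, sq_abs]
    nlinarith
  have hlower : γ K * μ Set.univ ≤ (γ.prod μ) W₀ + δ * γ K +
      ENNReal.ofReal (Real.exp (-t ^ 2 / 125000)) * μ Set.univ := by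
    have hGp : (γ.prod μ) (Set.univ ×ˢ Gᶜ) = 0 := by rw [Measure.prod_prod, hGc, mul_zero]
    have hsub : K ×ˢ Set.univ ⊆ W₀ ∪ (K ×ˢ Set.univ) ∩ {p : V × Ω | t / 250 < ⟪u p.2, p.1⟫} ∪
        (Set.univ ×ˢ G) ∩ {p : V × Ω | ⟪u p.2, p.1⟫ < -(t / 250)} ∪ Set.univ ×ˢ Gᶜ := by
      rintro ⟨g, ω⟩ ⟨hg, -⟩
      by_cases h1 : ω ∈ G
      swap
      · exact .inr ⟨trivial, h1⟩
      by_cases h2 : t / 250 < ⟪u ω, g⟫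
      · exact .inl (.inl (.inr ⟨⟨hg, trivial⟩, h2⟩))
      by_cases h3 : ⟪u ω, g⟫ < -(t / 250)
      · exact .inl (.inr ⟨⟨trivial, h1⟩, h3⟩)
      exact .inl (.inl (.inl ⟨h1, hg, not_lt.1 h3, not_lt.1 h2⟩))
    rw [← Measure.prod_prod]
    refine (measure_mono hsub).trans ((measure_union_le _ _).trans ?_)
    rw [hGp, add_zero]
    refine (measure_union_le _ _).trans (add_le_add ((measure_union_le _ _).trans
      (add_le_add le_rfl ?_)) ?_)
    · rw [Measure.prod_apply ((hK.prod .univ).inter hA), ← setLIntegral_const,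
        ← lintegral_indicator hK]
      refine lintegral_mono fun g ↦ ?_
      by_cases hg : g ∈ K
      · rw [Set.indicator_of_mem hg]
        exact (measure_mono fun ω h ↦ h.2).trans (le_of_lt hg)
      · have : Prod.mk g ⁻¹' ((K ×ˢ Set.univ) ∩ {p : V × Ω | t / 250 < ⟪u p.2, p.1⟫}) = ∅ := by
          ext; simp [hg]
        simp [this]
    · rw [Measure.prod_apply_symm ((MeasurableSet.univ.prod hG).inter hA'), ← lintegral_const]
      refine lintegral_mono fun ω ↦ ?_
      by_cases hω : ω ∈ G
      · refine (measure_mono fun g h ↦ h.2).trans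
          ((stdGaussianMeasure_inner_lt_le (hnorm ω hω) (r := t / 250) (by positivity)).trans_eq ?_)
        congr 2
        ring
      · have : (fun x ↦ (x, ω)) ⁻¹' ((Set.univ ×ˢ G) ∩
            {p : V × Ω | ⟪u p.2, p.1⟫ < -(t / 250)}) = ∅ := by
          ext; simp [hω]
        simp [this]
  have hfin : (γ.prod μ) W₀ ≤ ENNReal.ofReal (4 * Real.exp (-t ^ 2 / 2)) := by
    have he : 0 < Real.exp (-t ^ 2 / 2) := Real.exp_pos _
    have h1 := hshift.trans hupper
    rw [← ENNReal.le_div_iff_mul_le (by simp [he]) (by simp), ← ENNReal.ofReal_div_of_pos he] at h1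
    refine h1.trans_eq ?_
    rw [mul_div_assoc, ← Real.exp_sub]
    ring_nf
  obtain ⟨x, hx⟩ : ∃ x : ℝ, γ.real K = x := ⟨_, rfl⟩
  obtain ⟨m, hm'⟩ : ∃ m : ℝ, μ.real Set.univ = m := ⟨_, rfl⟩
  have hx0 : 0 ≤ x := hx ▸ measureReal_nonneg
  have hm0 : 0 ≤ m := hm' ▸ measureReal_nonneg
  have hxe : γ K = ENNReal.ofReal x := by rw [← hx, ofReal_measureReal]
  have hme : μ Set.univ = ENNReal.ofReal m := by rw [← hm', ofReal_measureReal]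
  have hquarter : (1 / 4 : ℝ≥0∞) = ENNReal.ofReal (1 / 4) := by
    rw [ENNReal.ofReal_div_of_pos (by norm_num)]; simp
  rw [hme, hquarter, ENNReal.ofReal_le_ofReal_iff hm0] at hm
  rw [hme, ENNReal.ofReal_le_one] at hm1
  have hmain := hlower.trans (add_le_add (add_le_add hfin le_rfl) le_rfl)
  rw [hxe, hme, ← ENNReal.ofReal_mul hx0, ← ENNReal.ofReal_mul (Real.exp_pos _).le,
    ← ENNReal.ofReal_mul (Real.exp_pos _).le, ← ENNReal.ofReal_add (by positivity) (by positivity),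
    ← ENNReal.ofReal_add (by positivity) (by positivity),
    ENNReal.ofReal_le_ofReal_iff (by positivity)] at hmain
  rw [hxe]
  refine ENNReal.ofReal_le_ofReal ?_
  have h8 : Real.exp (-t ^ 2) ≤ 1 / 8 := by
    rw [Real.exp_neg]
    have := Real.add_one_le_exp (t ^ 2)
    rw [one_div]
    exact inv_anti₀ (by norm_num) (by nlinarith)
  have h9 : Real.exp (-t ^ 2 / 2) ≤ Real.exp (-t ^ 2 / 125000) :=
    Real.exp_le_exp.2 (by nlinarith)
  have h10 : Real.exp (-t ^ 2 / 125000) * m ≤ Real.exp (-t ^ 2 / 125000) * 1 :=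
    mul_le_mul_of_nonneg_left hm1 (Real.exp_pos _).le
  nlinarith [mul_le_mul_of_nonneg_right h8 hx0, mul_le_mul_of_nonneg_left hm hx0]

end SudakovMinoration

section Sphere

variable {n : ℕ} {Ω : Type*} [MeasurableSpace Ω] {μ : Measure Ω} [IsFiniteMeasure μ]
  {u : Ω → EuclideanSpace ℝ (Fin n)}

lemma measurableSet_measure_inner_sphere_lt (hu : Measurable u) (s : ℝ) (δ : ℝ≥0∞) :
    MeasurableSet {θ : sphere (0 : EuclideanSpace ℝ (Fin n)) 1 |
      μ {ω | s < ⟪u ω, (θ : EuclideanSpace ℝ (Fin n))⟫} < δ} := by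
  have hA : MeasurableSet {p : sphere (0 : EuclideanSpace ℝ (Fin n)) 1 × Ω |
      s < ⟪u p.2, (p.1 : EuclideanSpace ℝ (Fin n))⟫} :=
    measurableSet_lt measurable_const (by fun_prop)
  exact measurableSet_lt (measurable_measure_prodMk_left hA) measurable_const

/-- The high-probability Sudakov minoration on the sphere. -/
lemma sphereMeasure_measure_inner_lt_le (hn : 1 ≤ n) (hu : Measurable u) {t : ℝ} (ht : 3 ≤ t)
    {G : Set Ω} (hG : MeasurableSet G) (hGc : μ Gᶜ = 0) (hnorm : ∀ ω ∈ G, ‖u ω‖ = 1)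
    (hball : ∀ ω ∈ G, μ {ω' | ‖u ω' - u ω‖ ≤ 1 / 5} ≤
      ENNReal.ofReal (2 * Real.exp (-t ^ 2)))
    (hm : (1 / 4 : ℝ≥0∞) ≤ μ Set.univ) (hm1 : μ Set.univ ≤ 1) :
    sphereMeasure n {θ | μ {ω | t / (500 * Real.sqrt n) <
        ⟪u ω, (θ : EuclideanSpace ℝ (Fin n))⟫} < ENNReal.ofReal (Real.exp (-t ^ 2))} ≤
      ENNReal.ofReal (160 * Real.exp (-t ^ 2 / 125000)) := by
  have hn0 : 0 < Real.sqrt n := Real.sqrt_pos.2 (by exact_mod_cast hn)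
  have hA : MeasurableSet {p : EuclideanSpace ℝ (Fin n) × Ω | t / 250 < ⟪u p.2, p.1⟫} :=
    measurableSet_lt measurable_const (by fun_prop)
  have h1 := stdGaussianMeasure_measure_inner_lt_le hu ht hG hGc hnorm hball hm hm1
  refine (sphereMeasure_le_four_mul_stdGaussianMeasure hn
    (measurableSet_measure_inner_sphere_lt hu _ _)
    (measurableSet_lt (measurable_measure_prodMk_left hA) measurable_const)
    fun θ hθ r hr hrn ↦ ?_).trans ((mul_le_mul_right h1 4).trans_eq ?_)
  · refine lt_of_le_of_lt (measure_mono fun ω hω ↦ ?_) hθ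
    change t / 250 < ⟪u ω, r • (θ : EuclideanSpace ℝ (Fin n))⟫ at hω
    rw [real_inner_smul_right] at hω
    rw [Set.mem_ofPred_eq, div_lt_iff₀ (by positivity)]
    have hpos : 0 < ⟪u ω, (θ : EuclideanSpace ℝ (Fin n))⟫ := by
      by_contra! h
      nlinarith [mul_nonneg_of_nonpos_of_nonpos (neg_nonpos.2 hr.le) h]
    nlinarith
  · rw [show (4 : ℝ≥0∞) = ENNReal.ofReal 4 by simp, ← ENNReal.ofReal_mul (by norm_num)]
    ring_nf

/-- Both one-sided Sudakov minorations hold simultaneously along the scales `2 ^ k * τ`, for all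
directions outside of a set of small spherical measure. -/
lemma exists_sphere_set_forall_dyadic_le_measure_inner (hn : 1 ≤ n) (hu : Measurable u)
    {τ t0 q : ℝ} (hτ : 3 ≤ τ) (hq : Real.exp (-τ ^ 2 / 125000) = q) (hq2 : q ≤ 1 / 2)
    {G : Set Ω} (hG : MeasurableSet G) (hGc : μ Gᶜ = 0) (hnorm : ∀ ω ∈ G, ‖u ω‖ = 1)
    (hball : ∀ ω ∈ G, μ {ω' | ‖u ω' - u ω‖ ≤ 1 / 5} ≤
      ENNReal.ofReal (2 * Real.exp (-t0 ^ 2)))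
    (hm : (1 / 4 : ℝ≥0∞) ≤ μ Set.univ) (hm1 : μ Set.univ ≤ 1) :
    ∃ F : Set (sphere (0 : EuclideanSpace ℝ (Fin n)) 1),
      ENNReal.ofReal (1 - 640 * q) ≤ sphereMeasure n F ∧
      ∀ θ ∈ F, ∀ k : ℕ, 2 ^ k * τ ≤ t0 →
        ENNReal.ofReal (Real.exp (-(2 ^ k * τ) ^ 2)) ≤
          μ {ω | 2 ^ k * τ / (500 * Real.sqrt n) <
            ⟪u ω, (θ : EuclideanSpace ℝ (Fin n))⟫} ∧
        ENNReal.ofReal (Real.exp (-(2 ^ k * τ) ^ 2)) ≤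
          μ {ω | 2 ^ k * τ / (500 * Real.sqrt n) <
            ⟪-u ω, (θ : EuclideanSpace ℝ (Fin n))⟫} := by
  have := isProbabilityMeasure_sphereMeasure hn
  have hq0 : 0 < q := hq ▸ Real.exp_pos _
  let bad (v : Ω → EuclideanSpace ℝ (Fin n)) (k : ℕ) :
      Set (sphere (0 : EuclideanSpace ℝ (Fin n)) 1) :=
    {θ | 2 ^ k * τ ≤ t0 ∧ μ {ω | 2 ^ k * τ / (500 * Real.sqrt n) <
      ⟪v ω, (θ : EuclideanSpace ℝ (Fin n))⟫} < ENNReal.ofReal (Real.exp (-(2 ^ k * τ) ^ 2))}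
  have hmeas : ∀ v : Ω → EuclideanSpace ℝ (Fin n), Measurable v → ∀ k,
      MeasurableSet (bad v k) := fun v hv k ↦
    (MeasurableSet.const _).inter (measurableSet_measure_inner_sphere_lt hv _ _)
  have hbad : ∀ v : Ω → EuclideanSpace ℝ (Fin n), Measurable v → (∀ ω ∈ G, ‖v ω‖ = 1) →
      (∀ ω ∈ G, μ {ω' | ‖v ω' - v ω‖ ≤ 1 / 5} ≤ ENNReal.ofReal (2 * Real.exp (-t0 ^ 2))) →
      ∀ k, sphereMeasure n (bad v k) ≤ ENNReal.ofReal (160 * q) * ENNReal.ofReal q ^ k := by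
    intro v hv hv1 hvb k
    by_cases hk : 2 ^ k * τ ≤ t0
    swap
    · have : bad v k = ∅ := by ext; simp [bad, hk]
      simp [this]
    have h1k : (1 : ℝ) ≤ 2 ^ k := one_le_pow₀ (by norm_num)
    have htk : 3 ≤ 2 ^ k * τ := by nlinarith
    refine (measure_mono fun θ hθ ↦ hθ.2).trans ((sphereMeasure_measure_inner_lt_le hn hv htk
      hG hGc hv1 (fun ω hω ↦ (hvb ω hω).trans ?_) hm hm1).trans ?_)
    · refine ENNReal.ofReal_le_ofReal ?_
      gcongr
    · rw [← ENNReal.ofReal_pow hq0.le, ← ENNReal.ofReal_mul (by positivity)]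
      refine ENNReal.ofReal_le_ofReal ?_
      rw [mul_assoc, ← pow_succ', ← hq, ← Real.exp_nat_mul]
      refine mul_le_mul_of_nonneg_left (Real.exp_le_exp.2 ?_) (by norm_num)
      have h2k : ((k + 1 : ℕ) : ℝ) ≤ 2 ^ k := by exact_mod_cast Nat.lt_two_pow_self
      have h3 : ((k + 1 : ℕ) : ℝ) ≤ (2 ^ k) ^ 2 := by nlinarith
      rw [mul_pow]
      have := mul_le_mul_of_nonneg_right h3 (sq_nonneg τ)
      linarith
  have hunion : ∀ v : Ω → EuclideanSpace ℝ (Fin n), Measurable v → (∀ ω ∈ G, ‖v ω‖ = 1) →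
      (∀ ω ∈ G, μ {ω' | ‖v ω' - v ω‖ ≤ 1 / 5} ≤ ENNReal.ofReal (2 * Real.exp (-t0 ^ 2))) →
      sphereMeasure n (⋃ k, bad v k) ≤ ENNReal.ofReal (320 * q) := by
    intro v hv hv1 hvb
    refine (measure_iUnion_le _).trans ((ENNReal.tsum_le_tsum (hbad v hv hv1 hvb)).trans ?_)
    rw [ENNReal.tsum_mul_left, ENNReal.tsum_geometric,
      show (320 * q : ℝ) = 160 * q * 2 by ring, ENNReal.ofReal_mul (p := 160 * q) (by positivity)]
    refine mul_le_mul_right ?_ _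
    rw [← ENNReal.ofReal_one, ← ENNReal.ofReal_sub _ hq0.le,
      ← ENNReal.ofReal_inv_of_pos (by linarith)]
    refine ENNReal.ofReal_le_ofReal (inv_le_of_inv_le₀ (by norm_num) (by linarith))
  have hneg : ∀ ω ω', ‖-u ω' - -u ω‖ = ‖u ω' - u ω‖ := fun ω ω' ↦ by
    rw [← neg_sub', norm_neg]
  have hp := hunion u hu hnorm hball
  have hq' := hunion (fun ω ↦ -u ω) hu.neg (by simpa using hnorm) (by simpa only [hneg] using hball)
  have hB : MeasurableSet ((⋃ k, bad u k) ∪ ⋃ k, bad (fun ω ↦ -u ω) k) :=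
    (MeasurableSet.iUnion (hmeas u hu)).union (MeasurableSet.iUnion (hmeas _ hu.neg))
  refine ⟨((⋃ k, bad u k) ∪ ⋃ k, bad (fun ω ↦ -u ω) k)ᶜ, ?_, fun θ hθ k hk ↦ ?_⟩
  · rw [prob_compl_eq_one_sub hB, ENNReal.ofReal_sub _ (by positivity), ENNReal.ofReal_one]
    refine tsub_le_tsub_left ((measure_union_le _ _).trans ((add_le_add hp hq').trans_eq ?_)) _
    rw [← ENNReal.ofReal_add (by positivity) (by positivity)]
    ring_nf
  · simp only [Set.mem_compl_iff, Set.mem_union, Set.mem_iUnion, not_or, not_exists, bad,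
      Set.mem_ofPred_eq, not_and, not_lt] at hθ
    exact ⟨hθ.1 k hk, hθ.2 k hk⟩

end Sphere

lemma mul_le_inner_normalized_of_direction_inner {V : Type*} [NormedAddCommGroup V]
    [InnerProductSpace ℝ V] {x θ1 θ2 θ3 : V} {M s t : ℝ} (hM : 0 < M) (hx : M ≤ ‖x‖)
    (h1 : ‖θ1‖ = 1) (h2 : ‖θ2‖ = 1) (h3 : ‖θ3‖ = 1) (hs : 0 < s) (ht : 60000 ≤ t)
    (hx1 : |⟪‖x‖⁻¹ • x, θ1⟫| ≤ 15 / s) (hx2 : |⟪‖x‖⁻¹ • x, θ2⟫| ≤ 15 / s)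
    (hx3 : t / (1000 * s) ≤ ⟪‖x‖⁻¹ • x, θ3⟫) :
    1 / 6000 * (M / s) * t ≤ ⟪x, ‖θ1 - θ2 + θ3‖⁻¹ • (θ1 - θ2 + θ3)⟫ := by
  have hx0 : 0 < ‖x‖ := hM.trans_le hx
  have hw : t / (2000 * s) ≤ ⟪‖x‖⁻¹ • x, θ1 - θ2 + θ3⟫ := by
    rw [inner_add_right, inner_sub_right]
    have h5 : 15 / s + 15 / s + t / (2000 * s) ≤ t / (1000 * s) := by
      rw [show 15 / s + 15 / s + t / (2000 * s) = (60000 + t) / (2000 * s) by field_simp; ring,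
        div_le_div_iff₀ (by positivity) (by positivity)]
      nlinarith
    linarith [(abs_le.1 hx1).1, (abs_le.1 hx2).2]
  rw [real_inner_smul_left] at hw
  have hw3 : ‖θ1 - θ2 + θ3‖ ≤ 3 := by
    linarith [norm_add_le (θ1 - θ2) θ3, norm_sub_le θ1 θ2]
  have hts : 0 < t / (2000 * s) := by positivity
  have hw0 : 0 < ‖θ1 - θ2 + θ3‖ := by
    refine norm_pos_iff.2 fun h ↦ ?_
    rw [h, inner_zero_right, mul_zero] at hw
    linarith
  rw [real_inner_smul_right, inv_mul_eq_div, le_div_iff₀ hw0]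
  rw [inv_mul_eq_div, le_div_iff₀ hx0] at hw
  refine le_trans ?_ hw
  calc 1 / 6000 * (M / s) * t * ‖θ1 - θ2 + θ3‖
      ≤ 1 / 6000 * (M / s) * t * 3 := by gcongr
    _ = t / (2000 * s) * M := by field_simp; norm_num
    _ ≤ t / (2000 * s) * ‖x‖ := by gcongr

lemma measure_lt_abs_inner_direction_le {n : ℕ} (hn : 1 ≤ n) {Ω : Type*} [MeasurableSpace Ω]
    {P : Measure Ω} [IsProbabilityMeasure P] {X : Ω → EuclideanSpace ℝ (Fin n)}
    (hX : Measurable X) {θ : EuclideanSpace ℝ (Fin n)} (hθ : ‖θ‖ = 1)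
    (hvar : ∫ ω, ⟪‖X ω‖⁻¹ • X ω, θ⟫ ^ 2 ∂P ≤ 5 / n) :
    P {ω | 15 / Real.sqrt n < |⟪‖X ω‖⁻¹ • X ω, θ⟫|} ≤ ENNReal.ofReal (1 / 45) := by
  have hnpos : (0 : ℝ) < n := by exact_mod_cast hn
  have hbound : ∀ ω, ⟪‖X ω‖⁻¹ • X ω, θ⟫ ^ 2 ≤ 1 := fun ω ↦ by
    rw [sq_le_one_iff_abs_le_one]
    refine (abs_real_inner_le_norm _ _).trans ?_
    rw [hθ, mul_one, norm_smul, norm_inv, norm_norm]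
    exact inv_mul_le_one
  have hintegrable : Integrable (fun ω ↦ ⟪‖X ω‖⁻¹ • X ω, θ⟫ ^ 2) P :=
    Integrable.of_bound (by fun_prop) 1 (Filter.Eventually.of_forall fun ω ↦ by
      rw [Real.norm_of_nonneg (sq_nonneg _)]; exact hbound ω)
  have h := mul_meas_ge_le_integral_of_nonneg
    (Filter.Eventually.of_forall fun ω ↦ sq_nonneg ⟪‖X ω‖⁻¹ • X ω, θ⟫) hintegrable (225 / n)
  have hsub : P.real {ω | 15 / Real.sqrt n < |⟪‖X ω‖⁻¹ • X ω, θ⟫|} ≤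
      P.real {ω | 225 / (n : ℝ) ≤ ⟪‖X ω‖⁻¹ • X ω, θ⟫ ^ 2} := by
    refine measureReal_mono fun ω hω ↦ ?_
    rw [Set.mem_ofPred_eq] at hω
    have h1 := pow_le_pow_left₀ (by positivity) hω.le 2
    rw [sq_abs, div_pow, Real.sq_sqrt hnpos.le] at h1
    norm_num at h1
    exact h1
  rw [← ofReal_measureReal]
  refine ENNReal.ofReal_le_ofReal (hsub.trans ?_)
  have h2 := h.trans hvar
  rw [div_mul_eq_mul_div, div_le_div_iff_of_pos_right hnpos] at h2
  linarith

/-- **Corollary 4.6 (Sudakov regime).** Assume `t0 ≥ 5√(log n)`. There is a fixed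
set `F ⊆ S^{n-1}` with `σ_{n-1}(F) ≥ 1 - C/n^c` such that for every `θ3 ∈ F`, setting
`θ = (θ1 - θ2 + θ3)/|θ1 - θ2 + θ3|`, for all `t ∈ [√(log n), t0]`:
`min {P(⟨X, θ⟩ ≥ c1 (M/√n) t), P(⟨X, θ⟩ ≤ -c1 (M/√n) t)} ≥ c2 e^{-C3 t²}`. -/
theorem supergaussian_tail_sudakov_regime :
    ∃ c C c1 c2 C3 : ℝ, 0 < c ∧ 0 < C ∧ 0 < c1 ∧ 0 < c2 ∧ 0 < C3 ∧
      ∀ (n : ℕ), 1 ≤ n →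
      ∀ (t0 : ℝ), 5 * Real.sqrt (Real.log n) ≤ t0 →
      ∀ (Ω : Type) (_ : MeasurableSpace Ω) (P : Measure Ω),
        IsProbabilityMeasure P →
      ∀ X : Ω → EuclideanSpace ℝ (Fin n), Measurable X →
        P {ω | X ω = 0} = 0 →
        (∀ θ : EuclideanSpace ℝ (Fin n), ‖θ‖ = 1 →
          ∫ ω, ⟪‖X ω‖⁻¹ • X ω, θ⟫ ^ 2 ∂P ≤ 5 / n) →
      ∀ (M : ℝ), 0 < M →
        (1 / 3 : ℝ≥0∞) ≤ P {ω | M ≤ ‖X ω‖} →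
        (2 / 3 : ℝ≥0∞) ≤ P {ω | ‖X ω‖ ≤ M} →
      ∀ (θ1 θ2 : EuclideanSpace ℝ (Fin n)), ‖θ1‖ = 1 → ‖θ2‖ = 1 →
        (∀ v : EuclideanSpace ℝ (Fin n), ‖v‖ = 1 → |⟪v, θ1⟫| ≤ 1 / 10 →
          P {ω | M ≤ ‖X ω‖ ∧ ‖‖X ω‖⁻¹ • X ω - v‖ ≤ 1 / 5} ≤
            ENNReal.ofReal (2 * Real.exp (-t0 ^ 2))) →
        ∃ F : Set (sphere (0 : EuclideanSpace ℝ (Fin n)) 1),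
          ENNReal.ofReal (1 - C / (n : ℝ) ^ c) ≤ sphereMeasure n F ∧
          ∀ θ3 ∈ F, ∀ t : ℝ, Real.sqrt (Real.log n) ≤ t → t ≤ t0 →
            ENNReal.ofReal (c2 * Real.exp (-C3 * t ^ 2)) ≤
              min
                (P {ω | c1 * (M / Real.sqrt n) * t ≤
                  ⟪X ω, ‖θ1 - θ2 + (θ3 : EuclideanSpace ℝ (Fin n))‖⁻¹ •
                    (θ1 - θ2 + (θ3 : EuclideanSpace ℝ (Fin n)))⟫})
                (P {ω | ⟪X ω, ‖θ1 - θ2 + (θ3 : EuclideanSpace ℝ (Fin n))‖⁻¹ •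
                    (θ1 - θ2 + (θ3 : EuclideanSpace ℝ (Fin n)))⟫ ≤
                  -(c1 * (M / Real.sqrt n) * t)}) := by
  refine ⟨1 / 125000, 640 * Real.exp 28800, 1 / 6000, 1, 1, by norm_num, by positivity,
    by norm_num, by norm_num, by norm_num, ?_⟩
  intro n hn t0 ht0 Ω _ P hP X hX hX0 hvar M hM hM1 _ θ1 θ2 hθ1 hθ2 hsmall
  have hnpos : (0 : ℝ) < n := by exact_mod_cast hn
  have hnc : (n : ℝ) ^ (1 / 125000 : ℝ) = Real.exp (Real.log n / 125000) := by
    rw [Real.rpow_def_of_pos hnpos]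
    ring_nf
  by_cases hL : Real.log n < 3600000000
  · refine ⟨∅, ?_, by simp⟩
    rw [measure_empty, nonpos_iff_eq_zero, ENNReal.ofReal_eq_zero, sub_nonpos,
      le_div_iff₀ (by positivity), one_mul, hnc]
    have h1 : Real.exp (Real.log n / 125000) ≤ Real.exp 28800 :=
      Real.exp_le_exp.2 (by linarith)
    linarith [Real.exp_pos 28800]
  rw [not_lt] at hL
  have hτ2 := Real.sq_sqrt (show (0 : ℝ) ≤ Real.log n by linarith)
  set τ := Real.sqrt (Real.log n)
  have hτ : 60000 ≤ τ := Real.le_sqrt_of_sq_le (by norm_num; exact hL)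
  have hsn : 150 ≤ Real.sqrt n := by
    refine Real.le_sqrt_of_sq_le ?_
    linarith [Real.add_one_le_exp (Real.log n), Real.exp_log hnpos]
  have hq : Real.exp (-τ ^ 2 / 125000) = ((n : ℝ) ^ (1 / 125000 : ℝ))⁻¹ := by
    rw [hτ2, hnc, ← Real.exp_neg, neg_div]
  have hq2 : Real.exp (-τ ^ 2 / 125000) ≤ 1 / 2 := by
    rw [hτ2, neg_div, Real.exp_neg, one_div]
    exact inv_anti₀ (by norm_num) (by linarith [Real.add_one_le_exp (Real.log n / 125000)])
  set u : Ω → EuclideanSpace ℝ (Fin n) := fun ω ↦ ‖X ω‖⁻¹ • X ω with hu_def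
  have hu : Measurable u := by fun_prop
  let G : Set Ω := {ω | M ≤ ‖X ω‖ ∧ |⟪u ω, θ1⟫| ≤ 15 / Real.sqrt n ∧
    |⟪u ω, θ2⟫| ≤ 15 / Real.sqrt n}
  have hG : MeasurableSet G :=
    (measurableSet_le (f := fun _ ↦ M) measurable_const (by fun_prop)).inter
      ((measurableSet_le (f := fun ω ↦ |⟪u ω, θ1⟫|) (g := fun _ ↦ 15 / Real.sqrt n)
        (measurable_norm.comp (by fun_prop : Measurable fun ω ↦ ⟪u ω, θ1⟫))
          measurable_const).inter
      (measurableSet_le (f := fun ω ↦ |⟪u ω, θ2⟫|) (g := fun _ ↦ 15 / Real.sqrt n)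
        (measurable_norm.comp (by fun_prop : Measurable fun ω ↦ ⟪u ω, θ2⟫))
          measurable_const))
  have hnorm : ∀ ω ∈ G, ‖u ω‖ = 1 := fun ω hω ↦ by
    have : 0 < ‖X ω‖ := hM.trans_le hω.1
    rw [hu_def, norm_smul, norm_inv, norm_norm, inv_mul_cancel₀ this.ne']
  have hPG : (1 / 4 : ℝ≥0∞) ≤ P G := by
    have hsub : {ω | M ≤ ‖X ω‖} ⊆ G ∪ {ω | 15 / Real.sqrt n < |⟪u ω, θ1⟫|} ∪
        {ω | 15 / Real.sqrt n < |⟪u ω, θ2⟫|} := by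
      intro ω hω
      by_cases h1 : 15 / Real.sqrt n < |⟪u ω, θ1⟫|
      · exact .inl (.inr h1)
      by_cases h2 : 15 / Real.sqrt n < |⟪u ω, θ2⟫|
      · exact .inr h2
      exact .inl (.inl ⟨hω, not_lt.1 h1, not_lt.1 h2⟩)
    have hdev : ∀ θ, ‖θ‖ = 1 → P {ω | 15 / Real.sqrt n < |⟪u ω, θ⟫|} ≤
        ENNReal.ofReal (1 / 45) := fun θ hθ ↦
      measure_lt_abs_inner_direction_le hn hX hθ (hvar θ hθ)
    have h := hM1.trans ((measure_mono hsub).trans ((measure_union_le _ _).trans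
      (add_le_add ((measure_union_le _ _).trans (add_le_add le_rfl (hdev θ1 hθ1)))
        (hdev θ2 hθ2))))
    have h3 : (1 / 3 : ℝ≥0∞) = ENNReal.ofReal (1 / 3) := by
      rw [ENNReal.ofReal_div_of_pos (by norm_num)]; simp
    have h4 : (1 / 4 : ℝ≥0∞) = ENNReal.ofReal (1 / 4) := by
      rw [ENNReal.ofReal_div_of_pos (by norm_num)]; simp
    rw [← ofReal_measureReal (s := G)] at h ⊢
    rw [h3, ← ENNReal.ofReal_add measureReal_nonneg (by norm_num),
      ← ENNReal.ofReal_add (by positivity) (by norm_num),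
      ENNReal.ofReal_le_ofReal_iff (by positivity)] at h
    rw [h4]
    exact ENNReal.ofReal_le_ofReal (by linarith)
  have h10 : 15 / Real.sqrt n ≤ 1 / 10 := by
    rw [div_le_div_iff₀ (by linarith) (by norm_num)]
    linarith
  obtain ⟨F, hF, hFk⟩ := exists_sphere_set_forall_dyadic_le_measure_inner
    (μ := P.restrict G) hn hu (t0 := t0) (by linarith) hq (hq ▸ hq2) hG
    (by rw [Measure.restrict_apply hG.compl]; simp) hnorm
    (fun ω hω ↦ by
      refine le_trans ?_ (hsmall (u ω) (hnorm ω hω) (hω.2.1.trans h10))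
      rw [Measure.restrict_apply' hG]
      exact measure_mono fun ω' h ↦ ⟨h.2.1, h.1⟩)
    (by rwa [Measure.restrict_apply_univ])
    (by rw [Measure.restrict_apply_univ]; exact prob_le_one)
  refine ⟨F, le_trans (ENNReal.ofReal_le_ofReal ?_) hF, fun θ3 hθ3 t htτ htt0 ↦ ?_⟩
  · rw [div_eq_mul_inv]
    have : 1 ≤ Real.exp 28800 := Real.one_le_exp (by norm_num)
    have : 0 < ((n : ℝ) ^ (1 / 125000 : ℝ))⁻¹ := by positivity
    nlinarith
  · have hτ0 : 0 < τ := by linarith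
    obtain ⟨k, hk1, hk2⟩ := exists_nat_pow_near (x := t / τ) (y := (2 : ℝ))
      ((one_le_div hτ0).2 htτ) (by norm_num)
    rw [le_div_iff₀ hτ0] at hk1
    rw [div_lt_iff₀ hτ0, pow_succ] at hk2
    obtain ⟨hp, hm⟩ := hFk θ3 hθ3 k (hk1.trans htt0)
    have hexp : ENNReal.ofReal (1 * Real.exp (-1 * t ^ 2)) ≤
        ENNReal.ofReal (Real.exp (-(2 ^ k * τ) ^ 2)) := by
      refine ENNReal.ofReal_le_ofReal ?_
      rw [one_mul, neg_one_mul]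
      gcongr
    have hscale : t / (1000 * Real.sqrt n) ≤ 2 ^ k * τ / (500 * Real.sqrt n) := by
      rw [div_le_div_iff₀ (by positivity) (by positivity)]
      nlinarith
    have hθ3n : ‖(θ3 : EuclideanSpace ℝ (Fin n))‖ = 1 := norm_eq_of_mem_sphere θ3
    rw [Measure.restrict_apply' hG] at hp hm
    refine le_min (hexp.trans (hp.trans (measure_mono fun ω hω ↦ ?_)))
      (hexp.trans (hm.trans (measure_mono fun ω hω ↦ ?_)))
    · exact mul_le_inner_normalized_of_direction_inner hM hω.2.1 hθ1 hθ2 hθ3n (by linarith)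
        (by linarith) hω.2.2.1 hω.2.2.2 (hscale.trans hω.1.le)
    · have h := mul_le_inner_normalized_of_direction_inner (x := -X ω) hM
        (by rw [norm_neg]; exact hω.2.1) hθ1 hθ2 hθ3n (s := Real.sqrt n) (t := t) (by linarith)
        (by linarith) (by rw [norm_neg, smul_neg, inner_neg_left, abs_neg]; exact hω.2.2.1)
        (by rw [norm_neg, smul_neg, inner_neg_left, abs_neg]; exact hω.2.2.2)
        (by rw [norm_neg, smul_neg]; exact hscale.trans hω.1.le)
      rw [inner_neg_left] at h
      exact le_neg_of_le_neg h
end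
end

section
/- Let d ≥ 1, let B be a finite-dimensional real vector space, and let X be a random vector in B whose effective rank is at least d (in particular P(X = 0) = 0). Then there exists a fixed scalar product ⟨·,·⟩ on B such that, writing |θ| = √⟨θ,θ⟩, one has E⟨X/|X|, θ⟩² ≤ |θ|²/d for all θ ∈ B. -/
open MeasureTheory
open scoped ENNReal

noncomputable section

/-- The random vector `X` in `B` has effective rank at least `d`. -/
def EffRankAtLeast {Ω B : Type*} [MeasurableSpace Ω] [AddCommGroup B] [Module ℝ B]
    (P : Measure Ω) (X : Ω → B) (d : ℝ) : Prop :=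
  ∀ E : Submodule ℝ B,
    P {ω | X ω ∈ E} ≤ ENNReal.ofReal (Module.finrank ℝ E / d) ∧
    (P {ω | X ω ∈ E} = ENNReal.ofReal (Module.finrank ℝ E / d) →
      ∃ F : Submodule ℝ B, IsCompl E F ∧ P {ω | X ω ∈ (E : Set B) ∪ (F : Set B)} = 1)

/-- The lower integral of `g` over the trace of `μ` on the (not necessarily measurable) set `D`:
values of `g` outside `D` are disregarded, and the result is `∞` times the inner measure of
`Dᶜ` when `D` does not have full outer measure. -/
def traceLIntegral {Ω : Type*} [MeasurableSpace Ω] (μ : Measure Ω) (D : Set Ω) (g : Ω → ℝ≥0∞) :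
    ℝ≥0∞ :=
  ∫⁻ ω, (open Classical in if ω ∈ D then g ω else ∞) ∂μ

section TraceLIntegral

variable {Ω : Type*} [MeasurableSpace Ω] {μ : Measure Ω} {D : Set Ω} {g h : Ω → ℝ≥0∞}

lemma traceLIntegral_mono_set {D' : Set Ω} (hD : D ⊆ D') (hgh : ∀ ω ∈ D, g ω ≤ h ω) :
    traceLIntegral μ D' g ≤ traceLIntegral μ D h := by
  refine lintegral_mono fun ω => ?_
  by_cases hω : ω ∈ D
  · simpa [hω, hD hω] using hgh ω hω
  · simp [hω]

lemma traceLIntegral_mono (hgh : ∀ ω ∈ D, g ω ≤ h ω) :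
    traceLIntegral μ D g ≤ traceLIntegral μ D h :=
  traceLIntegral_mono_set subset_rfl hgh

lemma le_traceLIntegral_add :
    traceLIntegral μ D g + traceLIntegral μ D h ≤ traceLIntegral μ D (fun ω => g ω + h ω) := by
  refine (le_lintegral_add _ _).trans (lintegral_mono fun ω => ?_)
  by_cases hω : ω ∈ D <;> simp [hω]

lemma traceLIntegral_add_const (c : ℝ≥0∞) :
    traceLIntegral μ D (fun ω => g ω + c) = traceLIntegral μ D g + c * μ Set.univ := by
  rw [traceLIntegral, traceLIntegral, ← lintegral_const, ← lintegral_add_right _ measurable_const]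
  refine lintegral_congr fun ω => ?_
  by_cases hω : ω ∈ D <;> simp [hω]

lemma traceLIntegral_const_mul_le {c : ℝ≥0∞} (hc : c ≠ ∞) :
    c * traceLIntegral μ D g ≤ traceLIntegral μ D (fun ω => c * g ω) := by
  rw [traceLIntegral, ← lintegral_const_mul' _ _ hc]
  refine lintegral_mono fun ω => ?_
  by_cases hω : ω ∈ D <;> simp [hω]

/-- A layer-cake bound for the lower integral. -/
lemma traceLIntegral_le_layers [IsFiniteMeasure μ] (m : ℕ) (c b : ℕ → ℝ) (hc0 : ∀ j, 0 ≤ c j)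
    (hc : ∀ j < m, c (j + 1) ≤ c j) (N : ℕ → Set Ω)
    (hND : ∀ j ≤ m, N j ⊆ D) (hN : ∀ j ≤ m, ∀ ω ∈ N j, g ω ≤ ENNReal.ofReal (c j))
    (hb : ∀ j ≤ m, μ.real Set.univ - μ.real (N j) ≤ b j) (hN0 : μ (N 0) = μ Set.univ) :
    traceLIntegral μ D g ≤
      ENNReal.ofReal (c m * μ.real Set.univ +
        ∑ j ∈ Finset.range m, (c j - c (j + 1)) * b (j + 1)) := by
  obtain ⟨f, hfm, hfle, hfeq⟩ := exists_measurable_le_lintegral_eq μ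
    (fun ω => (open Classical in if ω ∈ D then g ω else ∞))
  have hfN : ∀ j ≤ m, ∀ ω ∈ N j, f ω ≤ ENNReal.ofReal (c j) := fun j hj ω hω => by
    have h1 := hfle ω
    simp only [hND j hj hω, if_true] at h1
    exact h1.trans (hN j hj ω hω)
  have hmeas : ∀ j, MeasurableSet {ω | ENNReal.ofReal (c j) < f ω} := fun j =>
    measurableSet_lt measurable_const hfm
  have hcompl : ∀ j ≤ m, μ {ω | ENNReal.ofReal (c j) < f ω} ≤ ENNReal.ofReal (b j) := by
    intro j hj
    rw [← ofReal_measureReal]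
    refine ENNReal.ofReal_le_ofReal (le_trans ?_ (hb j hj))
    have h1 : μ.real (N j) ≤ μ.real {ω | ENNReal.ofReal (c j) < f ω}ᶜ :=
      measureReal_mono fun ω hω => by simpa using hfN j hj ω hω
    rw [measureReal_compl (hmeas j)] at h1
    linarith
  have key : ∀ k ≤ m, ∫⁻ ω, f ω ∂μ ≤ ∫⁻ ω, min (f ω) (ENNReal.ofReal (c k)) ∂μ +
      ENNReal.ofReal (∑ j ∈ Finset.range k, (c j - c (j + 1)) * b (j + 1)) := by
    have hb0 : ∀ j ≤ m, 0 ≤ b j := fun j hj => le_trans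
      (sub_nonneg.2 (measureReal_mono (Set.subset_univ _))) (hb j hj)
    intro k
    induction k with
    | zero =>
      intro _
      simp only [Finset.range_zero, Finset.sum_empty, ENNReal.ofReal_zero, add_zero]
      refine lintegral_mono_ae ?_
      have h0 : μ {ω | ENNReal.ofReal (c 0) < f ω} = 0 := by
        have h1 : μ Set.univ ≤ μ {ω | ENNReal.ofReal (c 0) < f ω}ᶜ := by
          rw [← hN0]
          exact measure_mono fun ω hω => by simpa using hfN 0 (Nat.zero_le _) ω hω
        have h2 := measure_add_measure_compl (μ := μ) (hmeas 0)
        have h3 : μ {ω | ENNReal.ofReal (c 0) < f ω} + μ Set.univ ≤ 0 + μ Set.univ := by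
          rw [zero_add]
          exact (add_le_add_right h1 _).trans h2.le
        exact nonpos_iff_eq_zero.1 ((ENNReal.add_le_add_iff_right (measure_ne_top _ _)).1 h3)
      have h4 : ∀ᵐ ω ∂μ, ¬ ENNReal.ofReal (c 0) < f ω := by
        rw [ae_iff]; simpa using h0
      filter_upwards [h4] with ω hω
      simpa using hω
    | succ k ih =>
      intro hk
      have hstep : ∫⁻ ω, min (f ω) (ENNReal.ofReal (c k)) ∂μ ≤
          ∫⁻ ω, min (f ω) (ENNReal.ofReal (c (k + 1))) ∂μ +
            ENNReal.ofReal ((c k - c (k + 1)) * b (k + 1)) := by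
        have hd := hc k hk
        calc ∫⁻ ω, min (f ω) (ENNReal.ofReal (c k)) ∂μ
            ≤ ∫⁻ ω, (min (f ω) (ENNReal.ofReal (c (k + 1))) +
              {ω | ENNReal.ofReal (c (k + 1)) < f ω}.indicator
                (fun _ => ENNReal.ofReal (c k - c (k + 1))) ω) ∂μ := by
              refine lintegral_mono fun ω => ?_
              by_cases hω : ENNReal.ofReal (c (k + 1)) < f ω
              · simp only [Set.indicator, Set.mem_ofPred_eq, hω, if_true, min_eq_right hω.le]
                rw [← ENNReal.ofReal_add (hc0 _) (by linarith)]
                refine (min_le_right _ _).trans (le_of_eq ?_)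
                congr 1; ring
              · simp only [Set.indicator, Set.mem_ofPred_eq, hω, if_false, add_zero]
                rw [min_eq_left (not_lt.1 hω)]
                exact min_le_left _ _
          _ = ∫⁻ ω, min (f ω) (ENNReal.ofReal (c (k + 1))) ∂μ +
              ENNReal.ofReal (c k - c (k + 1)) * μ {ω | ENNReal.ofReal (c (k + 1)) < f ω} := by
              rw [lintegral_add_left (hfm.min measurable_const),
                lintegral_indicator_const (hmeas _)]
          _ ≤ _ := by
              rw [ENNReal.ofReal_mul (by linarith)]
              gcongr
              exact hcompl _ hk
      rw [Finset.sum_range_succ, ENNReal.ofReal_add]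
      · refine (ih (by omega)).trans ?_
        refine (add_le_add_left hstep _).trans (le_of_eq ?_)
        rw [add_assoc, add_comm (ENNReal.ofReal ((c k - c (k + 1)) * b (k + 1)))]
      · refine Finset.sum_nonneg fun j hj => ?_
        rw [Finset.mem_range] at hj
        exact mul_nonneg (sub_nonneg.2 (hc j (by omega))) (hb0 _ (by omega))
      · exact mul_nonneg (sub_nonneg.2 (hc k hk)) (hb0 _ hk)
  rw [traceLIntegral, hfeq]
  refine (key m le_rfl).trans ?_
  have hb0 : ∀ j ≤ m, 0 ≤ b j := fun j hj => le_trans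
      (sub_nonneg.2 (measureReal_mono (Set.subset_univ _))) (hb j hj)
  rw [ENNReal.ofReal_add (mul_nonneg (hc0 _) measureReal_nonneg), ENNReal.ofReal_mul (hc0 _),
    ofReal_measureReal]
  · gcongr
    rw [← lintegral_const]
    exact lintegral_mono fun ω => min_le_right _ _
  · refine Finset.sum_nonneg fun j hj => ?_
    rw [Finset.mem_range] at hj
    exact mul_nonneg (sub_nonneg.2 (hc j (by omega))) (hb0 _ (by omega))

lemma traceLIntegral_le_const [IsFiniteMeasure μ] (hD : μ D = μ Set.univ) {c : ℝ} (hc : 0 ≤ c)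
    (hg : ∀ ω ∈ D, g ω ≤ ENNReal.ofReal c) :
    traceLIntegral μ D g ≤ ENNReal.ofReal (c * μ.real Set.univ) := by
  simpa using traceLIntegral_le_layers (μ := μ) (D := D) 0 (fun _ => c) (fun _ => 0)
    (fun _ => hc) (by simp) (fun _ => D) (by simp) (fun _ _ => hg)
    (by simp [measureReal_def, hD]) hD

end TraceLIntegral

section QuadraticForms

open Matrix

variable {n : ℕ}

/-- The quadratic form of a square matrix. -/
def quadForm (A : Matrix (Fin n) (Fin n) ℝ) (x : Fin n → ℝ) : ℝ := x ⬝ᵥ A *ᵥ x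

lemma quadForm_sub (A C : Matrix (Fin n) (Fin n) ℝ) (x : Fin n → ℝ) :
    quadForm (A - C) x = quadForm A x - quadForm C x := by
  simp [quadForm, sub_mulVec]

lemma quadForm_smul (c : ℝ) (A : Matrix (Fin n) (Fin n) ℝ) (x : Fin n → ℝ) :
    quadForm (c • A) x = c * quadForm A x := by
  simp [quadForm, smul_mulVec]

lemma quadForm_one (x : Fin n → ℝ) : quadForm 1 x = x ⬝ᵥ x := by simp [quadForm]

lemma quadForm_transpose_mul_diagonal_mul (U : Matrix (Fin n) (Fin n) ℝ) (l x : Fin n → ℝ) :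
    quadForm (Uᵀ * diagonal l * U) x = ∑ i, l i * (U *ᵥ x) i ^ 2 := by
  rw [quadForm, ← mulVec_mulVec, ← mulVec_mulVec, dotProduct_mulVec, vecMul_transpose]
  simp only [dotProduct, mulVec_diagonal]
  exact Finset.sum_congr rfl fun i _ => by ring

lemma sum_sq_mulVec_of_orthogonal {U : Matrix (Fin n) (Fin n) ℝ}
    (hU : U ∈ orthogonalGroup (Fin n) ℝ) (x : Fin n → ℝ) :
    ∑ i, (U *ᵥ x) i ^ 2 = x ⬝ᵥ x := by
  have h := quadForm_transpose_mul_diagonal_mul U 1 x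
  have hU' : Uᵀ * U = 1 := (mem_orthogonalGroup_iff' (Fin n) ℝ).1 hU
  simp only [Pi.one_apply, one_mul] at h
  rw [← h, show diagonal (1 : Fin n → ℝ) = 1 from diagonal_one, mul_one, hU', quadForm_one]

lemma det_transpose_mul_diagonal_mul {U : Matrix (Fin n) (Fin n) ℝ}
    (hU : U ∈ orthogonalGroup (Fin n) ℝ) (l : Fin n → ℝ) :
    (Uᵀ * diagonal l * U).det = ∏ i, l i := by
  have hU' : Uᵀ * U = 1 := (mem_orthogonalGroup_iff' (Fin n) ℝ).1 hU
  have h : Uᵀ.det * U.det = 1 := by rw [← det_mul, hU', det_one]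
  rw [det_mul, det_mul, det_diagonal, mul_right_comm, h, one_mul]

lemma exists_orthogonal_monotone_diagonalization {A : Matrix (Fin n) (Fin n) ℝ} (hA : A.IsSymm) :
    ∃ U ∈ orthogonalGroup (Fin n) ℝ, ∃ l : Fin n → ℝ, Monotone l ∧
      A = Uᵀ * diagonal l * U := by
  have hH : A.IsHermitian := by
    rw [IsHermitian, conjTranspose_eq_transpose_of_trivial]; exact hA
  set σ := Tuple.sort hH.eigenvalues
  set V : Matrix (Fin n) (Fin n) ℝ := hH.eigenvectorUnitary.1
  have hV : V * Vᵀ = 1 := (mem_orthogonalGroup_iff (Fin n) ℝ).1 hH.eigenvectorUnitary.2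
  have hV' : Vᵀ * V = 1 := (mem_orthogonalGroup_iff' (Fin n) ℝ).1 hH.eigenvectorUnitary.2
  have hspec : A = V * diagonal hH.eigenvalues * Vᵀ := by
    have := hH.spectral_theorem
    rw [Unitary.conjStarAlgAut_apply] at this
    exact this
  refine ⟨Vᵀ.submatrix σ id, ?_, hH.eigenvalues ∘ σ, Tuple.monotone_sort _, ?_⟩
  · rw [mem_orthogonalGroup_iff, transpose_submatrix, transpose_transpose]
    have : Vᵀ.submatrix σ id * V.submatrix id σ = (Vᵀ * V).submatrix σ σ :=
      submatrix_mul_equiv _ _ σ (Equiv.refl _) σ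
    rw [this, hV', submatrix_one_equiv]
  · rw [transpose_submatrix, transpose_transpose]
    have h1 : diagonal (hH.eigenvalues ∘ σ) = (diagonal hH.eigenvalues).submatrix σ σ :=
      (submatrix_diagonal_equiv _ σ).symm
    rw [h1, submatrix_mul_equiv, submatrix_mul_equiv, submatrix_id_id, ← hspec]

lemma abs_quadForm_le {C : Matrix (Fin n) (Fin n) ℝ} {ε : ℝ} (hC : ∀ i j, |C i j| ≤ ε)
    (x : Fin n → ℝ) : |quadForm C x| ≤ n * ε * (x ⬝ᵥ x) := by
  calc |quadForm C x| = |∑ i, ∑ j, x i * (C i j * x j)| := by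
        simp [quadForm, dotProduct, mulVec, Finset.mul_sum]
    _ ≤ ∑ i, ∑ j, |x i * (C i j * x j)| :=
        (Finset.abs_sum_le_sum_abs _ _).trans
          (Finset.sum_le_sum fun i _ => Finset.abs_sum_le_sum_abs _ _)
    _ ≤ ∑ i, ∑ j, ε * ((x i ^ 2 + x j ^ 2) / 2) := by
        refine Finset.sum_le_sum fun i _ => Finset.sum_le_sum fun j _ => ?_
        have h0 : |x i * (C i j * x j)| = |C i j| * (|x i| * |x j|) := by
          rw [abs_mul, abs_mul]; ring
        rw [h0]
        have h1 : |x i| * |x j| ≤ (x i ^ 2 + x j ^ 2) / 2 := by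
          nlinarith [sq_nonneg (|x i| - |x j|), sq_abs (x i), sq_abs (x j)]
        exact mul_le_mul (hC i j) h1 (by positivity) ((abs_nonneg _).trans (hC i j))
    _ = n * ε * (x ⬝ᵥ x) := by
        simp only [← Finset.mul_sum, ← Finset.sum_div, Finset.sum_add_distrib, Finset.sum_const,
          Finset.card_univ, Fintype.card_fin, nsmul_eq_mul, dotProduct, ← sq]
        ring

lemma dotProduct_mulVec_comm {A : Matrix (Fin n) (Fin n) ℝ} (hA : A.IsSymm) (x y : Fin n → ℝ) :
    x ⬝ᵥ A *ᵥ y = y ⬝ᵥ A *ᵥ x := by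
  rw [dotProduct_mulVec, ← mulVec_transpose, hA.eq, dotProduct_comm]

lemma sq_dotProduct_mulVec_le {A : Matrix (Fin n) (Fin n) ℝ} (hA : A.IsSymm)
    (hpos : ∀ x, 0 ≤ quadForm A x) (x y : Fin n → ℝ) :
    (x ⬝ᵥ A *ᵥ y) ^ 2 ≤ quadForm A x * quadForm A y := by
  have key : ∀ s : ℝ, 0 ≤ quadForm A y * (s * s) + 2 * (x ⬝ᵥ A *ᵥ y) * s + quadForm A x := by
    intro s
    have h := hpos (x + s • y)
    have h2 : quadForm A (x + s • y) =
        quadForm A y * (s * s) + 2 * (x ⬝ᵥ A *ᵥ y) * s + quadForm A x := by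
      simp only [quadForm, mulVec_add, mulVec_smul, dotProduct_add, add_dotProduct,
        dotProduct_smul, smul_dotProduct, smul_eq_mul]
      rw [dotProduct_mulVec_comm hA y x]
      ring
    rwa [h2] at h
  have := discrim_le_zero key
  rw [discrim] at this
  nlinarith

lemma quadForm_vecMulVec (v x : Fin n → ℝ) : quadForm (vecMulVec v v) x = (x ⬝ᵥ v) ^ 2 := by
  rw [quadForm, vecMulVec_mulVec]
  simp [dotProduct_smul, dotProduct_comm v x, sq]

lemma det_sub_smul_vecMulVec (A : Matrix (Fin n) (Fin n) ℝ) (t : ℝ) (y : Fin n → ℝ) :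
    (A - t • vecMulVec (A *ᵥ y) (A *ᵥ y)).det = A.det * (1 - t * quadForm A y) := by
  have h : A - t • vecMulVec (A *ᵥ y) (A *ᵥ y) =
      A * (1 + replicateCol Unit (-t • y) * replicateRow Unit (A *ᵥ y)) := by
    rw [mul_add, mul_one, ← vecMulVec_eq, mul_vecMulVec, mulVec_smul, smul_vecMulVec, neg_smul,
      sub_eq_add_neg]
  rw [h, det_mul, det_one_add_replicateCol_mul_replicateRow, quadForm, dotProduct_smul,
    dotProduct_comm, smul_eq_mul]
  ring

lemma mulVec_transpose_mulVec_of_orthogonal {U : Matrix (Fin n) (Fin n) ℝ}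
    (hU : U ∈ orthogonalGroup (Fin n) ℝ) (x : Fin n → ℝ) : U *ᵥ (Uᵀ *ᵥ x) = x := by
  have h : U * Uᵀ = 1 := (mem_orthogonalGroup_iff (Fin n) ℝ).1 hU
  rw [mulVec_mulVec, h, one_mulVec]

lemma exists_quadForm_eq_coeff {U : Matrix (Fin n) (Fin n) ℝ}
    (hU : U ∈ orthogonalGroup (Fin n) ℝ) (l : Fin n → ℝ) (i : Fin n) :
    ∃ x : Fin n → ℝ, x ⬝ᵥ x = 1 ∧ quadForm (Uᵀ * diagonal l * U) x = l i := by
  refine ⟨Uᵀ *ᵥ Pi.single i 1, ?_, ?_⟩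
  · rw [← sum_sq_mulVec_of_orthogonal hU, mulVec_transpose_mulVec_of_orthogonal hU]
    simp [Pi.single_apply]
  · rw [quadForm_transpose_mul_diagonal_mul, mulVec_transpose_mulVec_of_orthogonal hU]
    simp [Pi.single_apply]

lemma mul_dotProduct_le_quadForm {U : Matrix (Fin n) (Fin n) ℝ}
    (hU : U ∈ orthogonalGroup (Fin n) ℝ) {l : Fin n → ℝ} {ε : ℝ} (hl : ∀ i, ε ≤ l i)
    (x : Fin n → ℝ) : ε * (x ⬝ᵥ x) ≤ quadForm (Uᵀ * diagonal l * U) x := by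
  rw [quadForm_transpose_mul_diagonal_mul, ← sum_sq_mulVec_of_orthogonal hU, Finset.mul_sum]
  exact Finset.sum_le_sum fun i _ => mul_le_mul_of_nonneg_right (hl i) (sq_nonneg _)

lemma quadForm_le_dotProduct {U : Matrix (Fin n) (Fin n) ℝ}
    (hU : U ∈ orthogonalGroup (Fin n) ℝ) {l : Fin n → ℝ} (hl : ∀ i, l i ≤ 1)
    (x : Fin n → ℝ) : quadForm (Uᵀ * diagonal l * U) x ≤ x ⬝ᵥ x := by
  rw [quadForm_transpose_mul_diagonal_mul, ← sum_sq_mulVec_of_orthogonal hU]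
  exact Finset.sum_le_sum fun i _ => mul_le_of_le_one_left (sq_nonneg _) (hl i)

lemma isSymm_transpose_mul_diagonal_mul (U : Matrix (Fin n) (Fin n) ℝ) (l : Fin n → ℝ) :
    (Uᵀ * diagonal l * U).IsSymm := by
  rw [IsSymm, transpose_mul, transpose_mul, transpose_transpose, diagonal_transpose, mul_assoc]

lemma isCompact_orthogonalGroup :
    IsCompact {U : Matrix (Fin n) (Fin n) ℝ | U ∈ orthogonalGroup (Fin n) ℝ} := by
  have hK : IsCompact (Set.univ.pi fun _ : Fin n => Set.univ.pi fun _ : Fin n =>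
      Set.Icc (-1 : ℝ) 1) :=
    isCompact_univ_pi fun _ => isCompact_univ_pi fun _ => isCompact_Icc
  refine IsCompact.of_isClosed_subset (X := Matrix (Fin n) (Fin n) ℝ) hK ?_ ?_
  · have : {U : Matrix (Fin n) (Fin n) ℝ | U ∈ orthogonalGroup (Fin n) ℝ} =
        {U | U * Uᵀ = 1} := by
      ext U
      exact mem_orthogonalGroup_iff (Fin n) ℝ
    rw [this]
    exact isClosed_eq (by fun_prop) continuous_const
  · intro U hU i _ j _
    exact abs_le.1 (entry_norm_bound_of_unitary hU i j)

/-- The projection, in the frame given by the rows of `U`, onto the coordinates `≥ j`. -/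
def tailForm (j : ℕ) (U : Matrix (Fin n) (Fin n) ℝ) : Matrix (Fin n) (Fin n) ℝ :=
  Uᵀ * diagonal (fun i : Fin n => if j ≤ (i : ℕ) then 1 else 0) * U

lemma continuous_tailForm (j : ℕ) :
    Continuous (tailForm j : Matrix (Fin n) (Fin n) ℝ → Matrix (Fin n) (Fin n) ℝ) := by
  unfold tailForm
  fun_prop

lemma mul_quadForm_tailForm_le (U : Matrix (Fin n) (Fin n) ℝ) {l : Fin n → ℝ} (hl : Monotone l)
    (hl0 : ∀ i, 0 ≤ l i) (j : Fin n) (x : Fin n → ℝ) :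
    l j * quadForm (tailForm j U) x ≤ quadForm (Uᵀ * diagonal l * U) x := by
  rw [tailForm, quadForm_transpose_mul_diagonal_mul, quadForm_transpose_mul_diagonal_mul,
    Finset.mul_sum]
  refine Finset.sum_le_sum fun i _ => ?_
  split_ifs with h
  · rw [one_mul]
    exact mul_le_mul_of_nonneg_right (hl (Fin.le_def.2 h)) (sq_nonneg _)
  · simpa using mul_nonneg (hl0 i) (sq_nonneg ((U *ᵥ x) i))

/-- The kernel of `tailForm j U`. -/
lemma exists_submodule_tailForm {U : Matrix (Fin n) (Fin n) ℝ}
    (hU : U ∈ orthogonalGroup (Fin n) ℝ) {j : ℕ} (hj : j ≤ n) :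
    ∃ H : Submodule ℝ (Fin n → ℝ), Module.finrank ℝ H = j ∧
      ∀ x, x ∉ H → 0 < quadForm (tailForm j U) x := by
  let L : (Fin n → ℝ) →ₗ[ℝ] ({i : Fin n // j ≤ (i : ℕ)} → ℝ) :=
    (LinearMap.funLeft ℝ ℝ Subtype.val) ∘ₗ U.mulVecLin
  have hL : Function.Surjective L := by
    intro y
    refine ⟨Uᵀ *ᵥ (fun i => if h : j ≤ (i : ℕ) then y ⟨i, h⟩ else 0), ?_⟩
    ext i
    simp [L, LinearMap.funLeft_apply, -mulVec_mulVec, mulVec_transpose_mulVec_of_orthogonal hU,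
      i.2]
  refine ⟨LinearMap.ker L, ?_, ?_⟩
  · have h := L.finrank_range_add_finrank_ker
    rw [LinearMap.range_eq_top.2 hL, finrank_top, Module.finrank_pi, Module.finrank_pi,
      Fintype.card_fin] at h
    have hcard : Fintype.card {i : Fin n // j ≤ (i : ℕ)} = n - j := by
      rw [Fintype.card_subtype]
      have := Fin.card_filter_val_lt (n := n) (m := j)
      have h2 := Finset.card_filter_add_card_filter_not (s := (Finset.univ : Finset (Fin n)))
        (fun i : Fin n => (i : ℕ) < j)
      simp only [not_lt, Finset.card_univ, Fintype.card_fin] at h2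
      omega
    omega
  · intro x hx
    rw [tailForm, quadForm_transpose_mul_diagonal_mul]
    have hne : L x ≠ 0 := hx
    obtain ⟨i, hi⟩ := Function.ne_iff.1 hne
    refine Finset.sum_pos' (fun i _ => by split_ifs <;> positivity) ⟨i.1, Finset.mem_univ _, ?_⟩
    have hi' : (U *ᵥ x) i.1 ≠ 0 := hi
    rw [if_pos i.2, one_mul]
    positivity

end QuadraticForms

section LogDeficit

open Matrix Filter Topology

variable {n : ℕ} {Ω : Type*} [MeasurableSpace Ω] {μ : Measure Ω} {D : Set Ω}
  {Y : Ω → Fin n → ℝ} {d : ℝ}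

/-- The lower integral of `log (⟨Y, Y⟩ / ⟨Y, A Y⟩)` over the trace of `μ` on `D`. -/
def logDeficit (μ : Measure Ω) (D : Set Ω) (Y : Ω → Fin n → ℝ) (A : Matrix (Fin n) (Fin n) ℝ) :
    ℝ≥0∞ :=
  traceLIntegral μ D fun ω => ENNReal.ofReal (Real.log ((Y ω ⬝ᵥ Y ω) / quadForm A (Y ω)))

/-- The functional maximized by the angularly isotropic scalar products. -/
def logPotential (μ : Measure Ω) (D : Set Ω) (Y : Ω → Fin n → ℝ) (d : ℝ)
    (A : Matrix (Fin n) (Fin n) ℝ) : ℝ :=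
  (logDeficit μ D Y A).toReal + Real.log A.det / d

lemma dotProduct_self_pos {x : Fin n → ℝ} (hx : x ≠ 0) : 0 < x ⬝ᵥ x :=
  lt_of_le_of_ne (Finset.sum_nonneg fun _ _ => mul_self_nonneg _)
    fun h => hx (dotProduct_self_eq_zero.1 h.symm)

lemma logDeficit_ne_top [IsFiniteMeasure μ] (hD : μ D = μ Set.univ) (hY : ∀ ω ∈ D, Y ω ≠ 0)
    {A : Matrix (Fin n) (Fin n) ℝ} {ε : ℝ} (hε : 0 < ε)
    (hA : ∀ x, ε * (x ⬝ᵥ x) ≤ quadForm A x) : logDeficit μ D Y A ≠ ∞ := by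
  have h : logDeficit μ D Y A ≤ ENNReal.ofReal (|Real.log (1 / ε)| * μ.real Set.univ) := by
    refine traceLIntegral_le_const hD (abs_nonneg _) fun ω hω => ENNReal.ofReal_le_ofReal ?_
    have h1 := dotProduct_self_pos (hY ω hω)
    have h2 := hA (Y ω)
    have h3 : 0 < quadForm A (Y ω) := lt_of_lt_of_le (by positivity) h2
    refine le_trans (Real.log_le_log (by positivity) ?_) (le_abs_self _)
    rw [div_le_div_iff₀ h3 hε]
    linarith
  exact ne_top_of_le_ne_top ENNReal.ofReal_ne_top h

lemma logDeficit_le_add (hY : ∀ ω ∈ D, Y ω ≠ 0) [IsFiniteMeasure μ]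
    {A A' : Matrix (Fin n) (Fin n) ℝ} {ε κ : ℝ} (hε : 0 < ε)
    (hA : ∀ x, ε * (x ⬝ᵥ x) ≤ quadForm A x) (hA' : ∀ x, ε * (x ⬝ᵥ x) ≤ quadForm A' x)
    (hκ : ∀ i j, |(A' - A) i j| ≤ κ) :
    logDeficit μ D Y A ≤
      logDeficit μ D Y A' + ENNReal.ofReal (n * κ / ε) * μ Set.univ := by
  rw [logDeficit, logDeficit, ← traceLIntegral_add_const]
  refine traceLIntegral_mono fun ω hω => ?_
  have h1 := dotProduct_self_pos (hY ω hω)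
  have h3 : 0 < quadForm A (Y ω) := lt_of_lt_of_le (by positivity) (hA (Y ω))
  have h3' : 0 < quadForm A' (Y ω) := lt_of_lt_of_le (by positivity) (hA' (Y ω))
  refine le_trans (ENNReal.ofReal_le_ofReal ?_) ENNReal.ofReal_add_le
  have h4 : Real.log ((Y ω ⬝ᵥ Y ω) / quadForm A (Y ω)) =
      Real.log ((Y ω ⬝ᵥ Y ω) / quadForm A' (Y ω)) +
        Real.log (quadForm A' (Y ω) / quadForm A (Y ω)) := by
    rw [Real.log_div h1.ne' h3.ne', Real.log_div h1.ne' h3'.ne', Real.log_div h3'.ne' h3.ne']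
    ring
  have h5 := Real.log_le_sub_one_of_pos (div_pos h3' h3)
  have h6 := (le_abs_self _).trans (abs_quadForm_le hκ (Y ω))
  rw [quadForm_sub] at h6
  have h7 : quadForm A' (Y ω) / quadForm A (Y ω) - 1 ≤ n * κ / ε := by
    rw [div_sub_one h3.ne', div_le_div_iff₀ h3 hε]
    have h8 : 0 ≤ n * κ * (Y ω ⬝ᵥ Y ω) :=
      (abs_nonneg _).trans (abs_quadForm_le hκ (Y ω))
    have h9 : 0 ≤ n * κ := nonneg_of_mul_nonneg_left h8 h1
    nlinarith [hA (Y ω), mul_le_mul_of_nonneg_left (hA (Y ω)) h9]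
  linarith

/-- The pairs `(U, l)` parametrizing symmetric matrices with spectrum in `[ε, 1]`. -/
def spectralPairs (n : ℕ) (ε : ℝ) : Set (Matrix (Fin n) (Fin n) ℝ × (Fin n → ℝ)) :=
  {U | U ∈ orthogonalGroup (Fin n) ℝ} ×ˢ Set.Icc (fun _ => ε) (fun _ => 1)

lemma isCompact_spectralPairs (ε : ℝ) : IsCompact (spectralPairs n ε) :=
  isCompact_orthogonalGroup.prod isCompact_Icc

lemma continuousOn_logPotential [IsFiniteMeasure μ] (hD : μ D = μ Set.univ)
    (hY : ∀ ω ∈ D, Y ω ≠ 0) {ε : ℝ} (hε : 0 < ε) :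
    ContinuousOn (fun p : Matrix (Fin n) (Fin n) ℝ × (Fin n → ℝ) =>
      logPotential μ D Y d (p.1ᵀ * diagonal p.2 * p.1)) (spectralPairs n ε) := by
  have hcont : Continuous fun p : Matrix (Fin n) (Fin n) ℝ × (Fin n → ℝ) =>
      p.1ᵀ * diagonal p.2 * p.1 := by fun_prop
  have hbd : ∀ p ∈ spectralPairs n ε, ∀ x, ε * (x ⬝ᵥ x) ≤
      quadForm (p.1ᵀ * diagonal p.2 * p.1) x :=
    fun p hp x => mul_dotProduct_le_quadForm hp.1 (fun i => hp.2.1 i) x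
  refine ContinuousOn.add ?_ ?_
  · intro p hp
    rw [Metric.continuousWithinAt_iff']
    intro η hη
    obtain ⟨κ, hκ0, hκ⟩ : ∃ κ : ℝ, 0 < κ ∧ n * κ / ε * μ.real Set.univ < η := by
      refine ⟨η * ε / (2 * (n * μ.real Set.univ + 1)), by positivity, ?_⟩
      have h0 : 0 ≤ (n : ℝ) * μ.real Set.univ := by positivity
      have : n * (η * ε / (2 * (n * μ.real Set.univ + 1))) / ε * μ.real Set.univ =
          η * (n * μ.real Set.univ / (2 * (n * μ.real Set.univ + 1))) := by
        field_simp
      rw [this]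
      refine mul_lt_of_lt_one_right hη ?_
      rw [div_lt_one (by positivity)]
      linarith
    have hev : ∀ᶠ q : Matrix (Fin n) (Fin n) ℝ × (Fin n → ℝ) in 𝓝 p, ∀ i j,
        |((q.1ᵀ * diagonal q.2 * q.1) - (p.1ᵀ * diagonal p.2 * p.1)) i j| < κ := by
      rw [eventually_all]
      intro i
      rw [eventually_all]
      intro j
      have hc : Continuous fun q : Matrix (Fin n) (Fin n) ℝ × (Fin n → ℝ) =>
          |((q.1ᵀ * diagonal q.2 * q.1) - (p.1ᵀ * diagonal p.2 * p.1)) i j| :=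
        ((hcont.sub continuous_const).matrix_elem i j).abs
      refine (hc.tendsto p).eventually_lt_const ?_
      simpa using hκ0
    filter_upwards [mem_nhdsWithin_of_mem_nhds hev, self_mem_nhdsWithin] with q hq hqK
    have hfin : ENNReal.ofReal (n * κ / ε) * μ Set.univ =
        ENNReal.ofReal (n * κ / ε * μ.real Set.univ) := by
      rw [ENNReal.ofReal_mul (by positivity), ofReal_measureReal]
    have hp1 := logDeficit_ne_top (μ := μ) hD hY hε (hbd p hp)
    have hq1 := logDeficit_ne_top (μ := μ) hD hY hε (hbd q hqK)
    have h1 := logDeficit_le_add (μ := μ) hY hε (hbd p hp) (hbd q hqK) (fun i j => (hq i j).le)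
    have h2 := logDeficit_le_add (μ := μ) hY hε (hbd q hqK) (hbd p hp) (fun i j => by
      rw [← neg_sub, neg_apply, abs_neg]
      exact (hq i j).le)
    rw [hfin] at h1 h2
    have h1' := ENNReal.toReal_mono (ENNReal.add_ne_top.2 ⟨hq1, ENNReal.ofReal_ne_top⟩) h1
    have h2' := ENNReal.toReal_mono (ENNReal.add_ne_top.2 ⟨hp1, ENNReal.ofReal_ne_top⟩) h2
    rw [ENNReal.toReal_add hq1 ENNReal.ofReal_ne_top, ENNReal.toReal_ofReal (by positivity)] at h1'
    rw [ENNReal.toReal_add hp1 ENNReal.ofReal_ne_top, ENNReal.toReal_ofReal (by positivity)] at h2'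
    rw [Real.dist_eq, abs_lt]
    constructor <;> linarith
  · refine ContinuousOn.div_const (ContinuousOn.log ?_ ?_) _
    · exact (hcont.matrix_det).continuousOn
    · intro p hp
      rw [det_transpose_mul_diagonal_mul hp.1]
      exact (Finset.prod_pos fun i _ => lt_of_lt_of_le hε (hp.2.1 i)).ne'

lemma eventually_forall_tail [IsFiniteMeasure μ]
    (hirr : ∀ H : Submodule ℝ (Fin n → ℝ), H ≠ ⊥ → H ≠ ⊤ →
      μ.real Set.univ < μ.real (D ∩ {ω | Y ω ∉ H}) + Module.finrank ℝ H / d)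
    {j : ℕ} (hj : 0 < j) (hjn : j < n) :
    ∀ᶠ δ in 𝓝 (0 : ℝ), ∀ U ∈ {U : Matrix (Fin n) (Fin n) ℝ | U ∈ orthogonalGroup (Fin n) ℝ},
      0 < δ → μ.real Set.univ + δ ≤
        μ.real (D ∩ {ω | δ * (Y ω ⬝ᵥ Y ω) < quadForm (tailForm j U) (Y ω)}) + j / d := by
  refine isCompact_orthogonalGroup.eventually_forall_of_forall_eventually fun U₀ hU₀ => ?_
  obtain ⟨H, hHdim, hH⟩ := exists_submodule_tailForm hU₀ hjn.le
  have hbot : H ≠ ⊥ := by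
    rintro rfl
    rw [finrank_bot] at hHdim
    omega
  have htop : H ≠ ⊤ := by
    rintro rfl
    rw [finrank_top, Module.finrank_pi, Fintype.card_fin] at hHdim
    omega
  have h1 := hirr H hbot htop
  rw [hHdim] at h1
  set N : ℕ → Set Ω := fun k =>
    D ∩ {ω | (1 / ((k : ℝ) + 1)) * (Y ω ⬝ᵥ Y ω) < quadForm (tailForm j U₀) (Y ω)} with hN
  have hself : ∀ x : Fin n → ℝ, 0 ≤ x ⬝ᵥ x := fun x =>
    Finset.sum_nonneg fun i _ => mul_self_nonneg _
  have hmono : Monotone N := by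
    intro k k' hkk ω hω
    refine ⟨hω.1, lt_of_le_of_lt (mul_le_mul_of_nonneg_right ?_ (hself _)) hω.2⟩
    exact one_div_le_one_div_of_le (by positivity) (by exact_mod_cast Nat.succ_le_succ hkk)
  have hsub : D ∩ {ω | Y ω ∉ H} ⊆ ⋃ k, N k := by
    intro ω hω
    have h2 := hH _ hω.2
    have h3 : Tendsto (fun k : ℕ => (1 / ((k : ℝ) + 1)) * (Y ω ⬝ᵥ Y ω)) atTop
        (𝓝 (0 * (Y ω ⬝ᵥ Y ω))) := tendsto_one_div_add_atTop_nhds_zero_nat.mul_const _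
    rw [zero_mul] at h3
    obtain ⟨k, hk⟩ := (h3.eventually_lt_const h2).exists
    exact Set.mem_iUnion.2 ⟨k, hω.1, hk⟩
  have hlim : Tendsto (fun k => μ.real (N k)) atTop (𝓝 (μ.real (⋃ k, N k))) :=
    (ENNReal.tendsto_toReal (measure_ne_top _ _)).comp (tendsto_measure_iUnion_atTop hmono)
  have h2 : μ.real Set.univ - j / d < μ.real (⋃ k, N k) := by
    have := measureReal_mono (μ := μ) hsub
    linarith
  obtain ⟨k, hk⟩ := (hlim.eventually_const_lt h2).exists
  obtain ⟨δ₀, hδ₀, hδk, hδg⟩ : ∃ δ₀ : ℝ, 0 < δ₀ ∧ 2 * δ₀ ≤ 1 / ((k : ℝ) + 1) ∧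
      δ₀ ≤ μ.real (N k) - (μ.real Set.univ - j / d) := by
    refine ⟨min (1 / ((k : ℝ) + 1) / 2) (μ.real (N k) - (μ.real Set.univ - j / d)),
      lt_min (by positivity) (by linarith), ?_, min_le_right _ _⟩
    have := min_le_left (1 / ((k : ℝ) + 1) / 2) (μ.real (N k) - (μ.real Set.univ - j / d))
    linarith
  have hev : ∀ᶠ U : Matrix (Fin n) (Fin n) ℝ in 𝓝 U₀, ∀ a b,
      |(tailForm j U - tailForm j U₀) a b| < δ₀ / n := by
    rw [eventually_all]
    intro a
    rw [eventually_all]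
    intro b
    have hc : Continuous fun U : Matrix (Fin n) (Fin n) ℝ =>
        |(tailForm j U - tailForm j U₀) a b| :=
      (((continuous_tailForm j).sub continuous_const).matrix_elem a b).abs
    refine (hc.tendsto U₀).eventually_lt_const ?_
    have hn : (0 : ℝ) < n := by exact_mod_cast (by omega : 0 < n)
    simpa using div_pos hδ₀ hn
  rw [nhds_prod_eq]
  filter_upwards [(eventually_lt_nhds hδ₀).prod_mk hev] with z hz hz0
  have hle : μ.real (N k) ≤ μ.real
      (D ∩ {ω | z.1 * (Y ω ⬝ᵥ Y ω) < quadForm (tailForm j z.2) (Y ω)}) := by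
    refine measureReal_mono fun ω hω => ⟨hω.1, ?_⟩
    have h3 : (1 / ((k : ℝ) + 1)) * (Y ω ⬝ᵥ Y ω) < quadForm (tailForm j U₀) (Y ω) := hω.2
    have h4 := (neg_abs_le _).trans' (neg_le_neg
      (abs_quadForm_le (fun a b => (hz.2 a b).le) (Y ω)))
    rw [quadForm_sub, mul_div_cancel₀] at h4
    · have h5 := mul_le_mul_of_nonneg_right hδk (hself (Y ω))
      have h6 := mul_le_mul_of_nonneg_right hz.1.le (hself (Y ω))
      show z.1 * (Y ω ⬝ᵥ Y ω) < quadForm (tailForm j z.2) (Y ω)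
      linarith
    · have : n ≠ 0 := by omega
      exact_mod_cast this
  have := hz.1
  linarith

lemma logPotential_le [IsFiniteMeasure μ] {m : ℕ} {Y : Ω → Fin (m + 1) → ℝ}
    (hD : μ D = μ Set.univ) (hY : ∀ ω ∈ D, Y ω ≠ 0)
    (hM : μ.real Set.univ ≤ ((m + 1 : ℕ) : ℝ) / d) {δ : ℝ} (hδ : 0 < δ) (hδ1 : δ ≤ 1)
    {U : Matrix (Fin (m + 1)) (Fin (m + 1)) ℝ} (hU : U ∈ orthogonalGroup (Fin (m + 1)) ℝ)
    (htail : ∀ j : ℕ, 0 < j → j < m + 1 → μ.real Set.univ + δ ≤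
        μ.real (D ∩ {ω | δ * (Y ω ⬝ᵥ Y ω) < quadForm (tailForm j U) (Y ω)}) + j / d)
    {l : Fin (m + 1) → ℝ} (hl : Monotone l) (hl0 : ∀ i, 0 < l i) (hl1 : ∀ i, l i ≤ 1) :
    logPotential μ D Y d (Uᵀ * diagonal l * U) ≤
      (m + 1) * Real.log (1 / δ) / d + δ * (Real.log (l 0) - Real.log (l (Fin.last m))) := by
  set C := Real.log (1 / δ) with hC
  have hC0 : 0 ≤ C := Real.log_nonneg (one_le_one_div hδ hδ1)
  let ix : ℕ → Fin (m + 1) := fun j => ⟨min j m, by omega⟩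
  let c : ℕ → ℝ := fun j => C - Real.log (l (ix j))
  let b : ℕ → ℝ := fun j => if j = 0 then 0 else j / d - δ
  let N : ℕ → Set Ω := fun j => if j = 0 then D else
    D ∩ {ω | δ * (Y ω ⬝ᵥ Y ω) < quadForm (tailForm j U) (Y ω)}
  have hc0 : ∀ j, 0 ≤ c j := fun j =>
    sub_nonneg.2 ((Real.log_nonpos (hl0 _).le (hl1 _)).trans hC0)
  have hcanti : ∀ j < m, c (j + 1) ≤ c j := fun j _ =>
    sub_le_sub_left (Real.log_le_log (hl0 _) (hl (Fin.mk_le_mk.2 (by omega)))) _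
  have hND : ∀ j ≤ m, N j ⊆ D := by
    intro j _
    by_cases h : j = 0
    · simp [N, h]
    · simp only [N, h, if_false]
      exact Set.inter_subset_left
  have hNc : ∀ j ≤ m, ∀ ω ∈ N j, ENNReal.ofReal
      (Real.log ((Y ω ⬝ᵥ Y ω) / quadForm (Uᵀ * diagonal l * U) (Y ω))) ≤
        ENNReal.ofReal (c j) := by
    intro j hj ω hω
    have hpos := dotProduct_self_pos (hY ω (hND j hj hω))
    have hlow : δ * l (ix j) * (Y ω ⬝ᵥ Y ω) ≤ quadForm (Uᵀ * diagonal l * U) (Y ω) := by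
      by_cases h : j = 0
      · have h1 := mul_dotProduct_le_quadForm hU (ε := l (ix j))
          (fun i => hl (show ix j ≤ i from Fin.le_def.2 (by simp [ix, h]))) (Y ω)
        refine le_trans ?_ h1
        rw [mul_assoc]
        exact mul_le_of_le_one_left (mul_nonneg (hl0 _).le hpos.le) hδ1
      · simp only [N, h, if_false] at hω
        have h1 := mul_quadForm_tailForm_le U hl (fun i => (hl0 i).le) (ix j) (Y ω)
        have h2 : ((ix j : Fin (m + 1)) : ℕ) = j := min_eq_left hj
        rw [h2] at h1
        have h3 : δ * (Y ω ⬝ᵥ Y ω) < quadForm (tailForm j U) (Y ω) := hω.2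
        have h4 := mul_le_mul_of_nonneg_left h3.le (hl0 (ix j)).le
        linarith
    have hb : 0 < δ * l (ix j) := mul_pos hδ (hl0 _)
    have hq : 0 < quadForm (Uᵀ * diagonal l * U) (Y ω) := lt_of_lt_of_le (by positivity) hlow
    refine ENNReal.ofReal_le_ofReal ?_
    have h5 : c j = Real.log (1 / (δ * l (ix j))) := by
      simp only [c, hC]
      rw [Real.log_div one_ne_zero hδ.ne', Real.log_div one_ne_zero hb.ne',
        Real.log_mul hδ.ne' (hl0 _).ne']
      ring
    rw [h5]
    refine Real.log_le_log (by positivity) ?_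
    rw [div_le_div_iff₀ hq hb]
    linarith
  have hb : ∀ j ≤ m, μ.real Set.univ - μ.real (N j) ≤ b j := by
    intro j hj
    by_cases h : j = 0
    · simp [N, b, h, measureReal_def, hD]
    · simp only [N, b, h, if_false]
      have := htail j (by omega) (by omega)
      linarith
  have hbnn : ∀ j ≤ m, 0 ≤ b j := fun j hj =>
    le_trans (sub_nonneg.2 (measureReal_mono (Set.subset_univ _))) (hb j hj)
  have hmain := traceLIntegral_le_layers (μ := μ) (D := D) m c b hc0 hcanti N hND hNc hb
    (by simpa [N] using hD)
  have hreal := ENNReal.toReal_le_of_le_ofReal (by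
    refine add_nonneg (mul_nonneg (hc0 _) measureReal_nonneg) (Finset.sum_nonneg fun j hj => ?_)
    rw [Finset.mem_range] at hj
    exact mul_nonneg (sub_nonneg.2 (hcanti j hj)) (hbnn _ hj)) hmain
  have habel : ∀ k : ℕ, ∑ j ∈ Finset.range k, (c j - c (j + 1)) * b (j + 1) =
      (∑ j ∈ Finset.range (k + 1), c j) / d - (k + 1) * c k / d - δ * (c 0 - c k) := by
    intro k
    induction k with
    | zero => simp
    | succ k ih =>
      rw [Finset.sum_range_succ, ih, Finset.sum_range_succ _ (k + 1)]
      simp only [b, Nat.succ_ne_zero, if_false]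
      push_cast
      ring
  have hdet : Real.log (Uᵀ * diagonal l * U).det =
      (m + 1) * C - ∑ j ∈ Finset.range (m + 1), c j := by
    rw [det_transpose_mul_diagonal_mul hU, Real.log_prod fun i _ => (hl0 i).ne',
      Finset.sum_range]
    have h1 : ∀ i : Fin (m + 1), c i = C - Real.log (l i) := by
      intro i
      have : ix i = i := Fin.ext (min_eq_left (by omega))
      simp [c, this]
    simp [h1]
  have hc_last : c m = C - Real.log (l (Fin.last m)) := by
    have : ix m = Fin.last m := Fin.ext (by simp [ix])
    simp [c, this]
  have hc_zero : c 0 = C - Real.log (l 0) := by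
    have : ix 0 = 0 := Fin.ext (by simp [ix])
    simp [c, this]
  rw [habel] at hreal
  have hcM := mul_le_mul_of_nonneg_left hM (hc0 m)
  have e1 : c m * (((m + 1 : ℕ) : ℝ) / d) = (m + 1) * c m / d := by push_cast; ring
  rw [e1] at hcM
  rw [logPotential, hdet, sub_div, logDeficit]
  have e2 : δ * (c 0 - c m) = -(δ * (Real.log (l 0) - Real.log (l (Fin.last m)))) := by
    rw [hc_last, hc_zero]; ring
  linarith

/-- Positive definite symmetric matrices that are dominated by the identity. -/
def PosDefLeOne (A : Matrix (Fin n) (Fin n) ℝ) : Prop :=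
  A.IsSymm ∧ (∃ ε > 0, ∀ x, ε * (x ⬝ᵥ x) ≤ quadForm A x) ∧ ∀ x, quadForm A x ≤ x ⬝ᵥ x

lemma PosDefLeOne.exists_diagonalization {A : Matrix (Fin n) (Fin n) ℝ} (hA : PosDefLeOne A) :
    ∃ U ∈ orthogonalGroup (Fin n) ℝ, ∃ l : Fin n → ℝ, Monotone l ∧ (∀ i, 0 < l i) ∧
      (∀ i, l i ≤ 1) ∧ A = Uᵀ * diagonal l * U := by
  obtain ⟨hsymm, ⟨ε, hε, hlow⟩, hup⟩ := hA
  obtain ⟨U, hU, l, hl, rfl⟩ := exists_orthogonal_monotone_diagonalization hsymm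
  refine ⟨U, hU, l, hl, fun i => ?_, fun i => ?_, rfl⟩
  · obtain ⟨x, hx, hxl⟩ := exists_quadForm_eq_coeff hU l i
    have := hlow x
    rw [hx, hxl] at this
    linarith
  · obtain ⟨x, hx, hxl⟩ := exists_quadForm_eq_coeff hU l i
    have := hup x
    rwa [hx, hxl] at this

lemma posDefLeOne_of_mem_spectralPairs {ε : ℝ} (hε : 0 < ε)
    {p : Matrix (Fin n) (Fin n) ℝ × (Fin n → ℝ)} (hp : p ∈ spectralPairs n ε) :
    PosDefLeOne (p.1ᵀ * diagonal p.2 * p.1) :=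
  ⟨isSymm_transpose_mul_diagonal_mul _ _,
    ⟨ε, hε, mul_dotProduct_le_quadForm hp.1 fun i => hp.2.1 i⟩,
    quadForm_le_dotProduct hp.1 fun i => hp.2.2 i⟩

lemma logPotential_le_smul [IsFiniteMeasure μ] (hD : μ D = μ Set.univ) (hY : ∀ ω ∈ D, Y ω ≠ 0)
    (hM : μ.real Set.univ ≤ n / d) {A : Matrix (Fin n) (Fin n) ℝ}
    (hA : PosDefLeOne A) {s : ℝ} (hs : 1 ≤ s) :
    logPotential μ D Y d A ≤ logPotential μ D Y d (s • A) := by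
  have hs0 : 0 < s := by linarith
  have hdet : 0 < A.det := by
    obtain ⟨U, hU, l, -, hl, -, rfl⟩ := hA.exists_diagonalization
    rw [det_transpose_mul_diagonal_mul hU]
    exact Finset.prod_pos fun i _ => hl i
  obtain ⟨-, ⟨ε, hε, hlow⟩, -⟩ := hA
  have hfin : logDeficit μ D Y (s • A) ≠ ∞ := by
    refine logDeficit_ne_top hD hY (mul_pos hs0 hε) fun x => ?_
    rw [quadForm_smul, mul_assoc]
    exact mul_le_mul_of_nonneg_left (hlow x) hs0.le
  have hle : logDeficit μ D Y A ≤
      logDeficit μ D Y (s • A) + ENNReal.ofReal (Real.log s) * μ Set.univ := by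
    rw [logDeficit, logDeficit, ← traceLIntegral_add_const]
    refine traceLIntegral_mono fun ω hω => ?_
    have h1 := dotProduct_self_pos (hY ω hω)
    have h3 : 0 < quadForm A (Y ω) := lt_of_lt_of_le (by positivity) (hlow (Y ω))
    refine le_trans (ENNReal.ofReal_le_ofReal (le_of_eq ?_)) ENNReal.ofReal_add_le
    rw [quadForm_smul, Real.log_div h1.ne' h3.ne', Real.log_div h1.ne' (by positivity),
      Real.log_mul hs0.ne' h3.ne']
    ring
  have hlogs := Real.log_nonneg hs
  rw [← ofReal_measureReal (μ := μ), ← ENNReal.ofReal_mul hlogs] at hle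
  have h1 := ENNReal.toReal_mono (ENNReal.add_ne_top.2 ⟨hfin, ENNReal.ofReal_ne_top⟩) hle
  rw [ENNReal.toReal_add hfin ENNReal.ofReal_ne_top, ENNReal.toReal_ofReal (by positivity)] at h1
  rw [logPotential, logPotential, det_smul, Fintype.card_fin,
    Real.log_mul (by positivity) hdet.ne', Real.log_pow, add_div]
  have h2 := mul_le_mul_of_nonneg_left hM hlogs
  have h3 : Real.log s * (n / d) = n * Real.log s / d := by ring
  linarith

lemma exists_isMax_logPotential [IsFiniteMeasure μ] {m : ℕ} {Y : Ω → Fin (m + 1) → ℝ}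
    (hD : μ D = μ Set.univ) (hY : ∀ ω ∈ D, Y ω ≠ 0) (hd : 0 < d)
    (hM : μ.real Set.univ ≤ ((m + 1 : ℕ) : ℝ) / d)
    (hirr : ∀ H : Submodule ℝ (Fin (m + 1) → ℝ), H ≠ ⊥ → H ≠ ⊤ →
      μ.real Set.univ < μ.real (D ∩ {ω | Y ω ∉ H}) + Module.finrank ℝ H / d) :
    ∃ A : Matrix (Fin (m + 1)) (Fin (m + 1)) ℝ, PosDefLeOne A ∧
      ∀ A', PosDefLeOne A' → logPotential μ D Y d A' ≤ logPotential μ D Y d A := by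
  have hev : ∀ᶠ δ in 𝓝[>] (0 : ℝ), ∀ j : Fin (m + 1), 0 < (j : ℕ) →
      ∀ U ∈ {U : Matrix (Fin (m + 1)) (Fin (m + 1)) ℝ | U ∈ orthogonalGroup (Fin (m + 1)) ℝ},
      0 < δ → μ.real Set.univ + δ ≤
        μ.real (D ∩ {ω | δ * (Y ω ⬝ᵥ Y ω) < quadForm (tailForm j U) (Y ω)}) +
          ((j : ℕ) : ℝ) / d := by
    rw [eventually_all]
    intro j
    by_cases hj : 0 < (j : ℕ)
    · filter_upwards [mem_nhdsWithin_of_mem_nhds (eventually_forall_tail hirr hj j.2)] with δ h _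
      exact h
    · exact Eventually.of_forall fun δ h => absurd h hj
  obtain ⟨δ, htail, hδ0, hδ1⟩ :=
    (hev.and (Ioc_mem_nhdsGT (zero_lt_one' ℝ))).exists
  have hcoer : ∀ U ∈ orthogonalGroup (Fin (m + 1)) ℝ, ∀ l : Fin (m + 1) → ℝ, Monotone l →
      (∀ i, 0 < l i) → (∀ i, l i ≤ 1) → logPotential μ D Y d (Uᵀ * diagonal l * U) ≤
      (m + 1) * Real.log (1 / δ) / d + δ * (Real.log (l 0) - Real.log (l (Fin.last m))) :=
    fun U hU l hl hl0 hl1 => logPotential_le hD hY hM hδ0 hδ1 hU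
      (fun j hj hjm => htail ⟨j, hjm⟩ hj U hU hδ0) hl hl0 hl1
  set K := (m + 1) * Real.log (1 / δ) / d with hK
  have hK0 : 0 ≤ K := by
    have := Real.log_nonneg (one_le_one_div hδ0 hδ1)
    positivity
  set ε := Real.exp (-(K / δ)) with hεdef
  have hε : 0 < ε := Real.exp_pos _
  have hε1 : ε ≤ 1 := Real.exp_le_one_iff.2 (by have : 0 ≤ K / δ := by positivity
                                                linarith)
  have hone : ((1 : Matrix (Fin (m + 1)) (Fin (m + 1)) ℝ), (fun _ : Fin (m + 1) => (1 : ℝ))) ∈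
      spectralPairs (m + 1) ε :=
    ⟨one_mem (orthogonalGroup (Fin (m + 1)) ℝ), fun _ => hε1, fun _ => le_rfl⟩
  obtain ⟨p, hp, hpmax⟩ := (isCompact_spectralPairs (n := m + 1) ε).exists_isMaxOn ⟨_, hone⟩
    (continuousOn_logPotential (d := d) hD hY hε)
  have hpmax' : ∀ (V : Matrix (Fin (m + 1)) (Fin (m + 1)) ℝ) (k : Fin (m + 1) → ℝ),
      V ∈ orthogonalGroup (Fin (m + 1)) ℝ → (∀ i, ε ≤ k i) → (∀ i, k i ≤ 1) →
      logPotential μ D Y d (Vᵀ * diagonal k * V) ≤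
        logPotential μ D Y d (p.1ᵀ * diagonal p.2 * p.1) :=
    fun V k hV hk hk1 => isMaxOn_iff.1 hpmax (V, k) ⟨hV, hk, hk1⟩
  refine ⟨_, posDefLeOne_of_mem_spectralPairs hε hp, fun A' hA' => ?_⟩
  have hp0 : 0 ≤ logPotential μ D Y d (p.1ᵀ * diagonal p.2 * p.1) := by
    refine le_trans ?_ (hpmax hone)
    simp [logPotential]
  obtain ⟨U, hU, l, hl, hl0, hl1, rfl⟩ := hA'.exists_diagonalization
  refine (logPotential_le_smul hD hY hM hA' (s := (l (Fin.last m))⁻¹)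
    ((one_le_inv₀ (hl0 _)).2 (hl1 _))).trans ?_
  set s := (l (Fin.last m))⁻¹ with hs
  have hs0 : 0 < s := inv_pos.2 (hl0 _)
  have hscale : s • (Uᵀ * diagonal l * U) = Uᵀ * diagonal (s • l) * U := by
    rw [diagonal_smul, Matrix.mul_smul, Matrix.smul_mul]
  have hl' : Monotone (s • l) := fun i j hij => mul_le_mul_of_nonneg_left (hl hij) hs0.le
  have hl0' : ∀ i, 0 < (s • l) i := fun i => mul_pos hs0 (hl0 i)
  have hlast : (s • l) (Fin.last m) = 1 := inv_mul_cancel₀ (hl0 _).ne'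
  have hl1' : ∀ i, (s • l) i ≤ 1 := fun i => (hl' (Fin.le_last i)).trans hlast.le
  rw [hscale]
  by_cases h : ε ≤ (s • l) 0
  · exact hpmax' U (s • l) hU (fun i => h.trans (hl' (Fin.zero_le i))) hl1'
  · refine (hcoer U hU _ hl' hl0' hl1').trans (le_trans ?_ hp0)
    rw [hlast, Real.log_one, sub_zero]
    have h1 : Real.log ((s • l) 0) ≤ -(K / δ) := by
      rw [← Real.log_exp (-(K / δ))]
      exact Real.log_le_log (hl0' 0) (not_le.1 h).le
    have h2 := mul_le_mul_of_nonneg_left h1 hδ0.le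
    have h3 : δ * -(K / δ) = -K := by field_simp
    linarith

/-- A maximizer of the potential is in angularly sub-isotropic position. -/
lemma traceLIntegral_le_of_isMax [IsFiniteMeasure μ] (hD : μ D = μ Set.univ)
    (hY : ∀ ω ∈ D, Y ω ≠ 0) (hd : 0 < d) {A : Matrix (Fin n) (Fin n) ℝ} (hA : PosDefLeOne A)
    (hmax : ∀ A', PosDefLeOne A' → logPotential μ D Y d A' ≤ logPotential μ D Y d A)
    (θ : Fin n → ℝ) :
    traceLIntegral μ D
        (fun ω => ENNReal.ofReal ((Y ω ⬝ᵥ A *ᵥ θ) ^ 2 / quadForm A (Y ω))) ≤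
      ENNReal.ofReal (quadForm A θ / d) := by
  set G := traceLIntegral μ D
        (fun ω => ENNReal.ofReal ((Y ω ⬝ᵥ A *ᵥ θ) ^ 2 / quadForm A (Y ω))) with hG
  have hdet : 0 < A.det := by
    obtain ⟨U, hU, l, -, hl, -, rfl⟩ := hA.exists_diagonalization
    rw [det_transpose_mul_diagonal_mul hU]
    exact Finset.prod_pos fun i _ => hl i
  obtain ⟨hsymm, ⟨ε, hε, hlow⟩, hup⟩ := hA
  have hself : ∀ x : Fin n → ℝ, 0 ≤ x ⬝ᵥ x := fun x =>
    Finset.sum_nonneg fun _ _ => mul_self_nonneg _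
  have hnn : ∀ x, 0 ≤ quadForm A x := fun x => (mul_nonneg hε.le (hself x)).trans (hlow x)
  set q := quadForm A θ with hq
  have hfin : logDeficit μ D Y A ≠ ∞ := logDeficit_ne_top hD hY hε hlow
  have key : ∀ t : ℝ, 0 < t → 0 < 1 - t * q → G ≠ ∞ ∧ G.toReal * (1 - t * q) ≤ q / d := by
    intro t ht htq
    set A' := A - t • vecMulVec (A *ᵥ θ) (A *ᵥ θ) with hA'
    have hform : ∀ x, quadForm A' x = quadForm A x - t * (x ⬝ᵥ A *ᵥ θ) ^ 2 := fun x => by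
      rw [hA', quadForm_sub, quadForm_smul, quadForm_vecMulVec]
    have hlow1 : ∀ x, (1 - t * q) * quadForm A x ≤ quadForm A' x := fun x => by
      rw [hform]
      have := mul_le_mul_of_nonneg_left (sq_dotProduct_mulVec_le hsymm hnn x θ) ht.le
      linarith
    have hlow' : ∀ x, ((1 - t * q) * ε) * (x ⬝ᵥ x) ≤ quadForm A' x := fun x => by
      rw [mul_assoc]
      exact (mul_le_mul_of_nonneg_left (hlow x) htq.le).trans (hlow1 x)
    have hadm : PosDefLeOne A' := by
      refine ⟨?_, ⟨_, mul_pos htq hε, hlow'⟩, fun x => ?_⟩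
      · rw [hA', IsSymm, transpose_sub, transpose_smul, transpose_vecMulVec, hsymm.eq]
      · rw [hform]
        have := hup x
        nlinarith [mul_nonneg ht.le (sq_nonneg (x ⬝ᵥ A *ᵥ θ))]
    have hfin' : logDeficit μ D Y A' ≠ ∞ := logDeficit_ne_top hD hY (mul_pos htq hε) hlow'
    have hsuper : logDeficit μ D Y A + ENNReal.ofReal t * G ≤ logDeficit μ D Y A' := by
      refine (add_le_add_right (traceLIntegral_const_mul_le
        ENNReal.ofReal_ne_top) _).trans (le_traceLIntegral_add.trans
          (traceLIntegral_mono fun ω hω => ?_))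
      have h1 := dotProduct_self_pos (hY ω hω)
      have h2 : 0 < quadForm A (Y ω) := lt_of_lt_of_le (by positivity) (hlow _)
      have h3 : 0 < quadForm A' (Y ω) := lt_of_lt_of_le (mul_pos htq h2) (hlow1 _)
      have h4 : 0 ≤ Real.log ((Y ω ⬝ᵥ Y ω) / quadForm A (Y ω)) :=
        Real.log_nonneg ((one_le_div h2).2 (hup _))
      rw [← ENNReal.ofReal_mul ht.le, ← ENNReal.ofReal_add h4 (by positivity)]
      refine ENNReal.ofReal_le_ofReal ?_
      rw [Real.log_div h1.ne' h2.ne', Real.log_div h1.ne' h3.ne']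
      have h5 := Real.log_le_sub_one_of_pos (div_pos h3 h2)
      rw [Real.log_div h3.ne' h2.ne', div_sub_one h2.ne', hform] at h5
      have h6 : (quadForm A (Y ω) - t * (Y ω ⬝ᵥ A *ᵥ θ) ^ 2 - quadForm A (Y ω)) /
          quadForm A (Y ω) = -(t * ((Y ω ⬝ᵥ A *ᵥ θ) ^ 2 / quadForm A (Y ω))) := by ring
      rw [h6, ← hform] at h5
      linarith
    have htG : ENNReal.ofReal t * G ≠ ∞ :=
      ne_top_of_le_ne_top hfin' (le_add_self.trans hsuper)
    have hGfin : G ≠ ∞ := by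
      intro h
      rw [h, ENNReal.mul_top (by simpa using ht)] at htG
      exact htG rfl
    refine ⟨hGfin, ?_⟩
    have h1 := ENNReal.toReal_mono hfin' hsuper
    rw [ENNReal.toReal_add hfin htG, ENNReal.toReal_mul, ENNReal.toReal_ofReal ht.le] at h1
    have h2 := hmax A' hadm
    rw [logPotential, logPotential, hA', det_sub_smul_vecMulVec, Real.log_mul hdet.ne' htq.ne',
      add_div, ← hA'] at h2
    have h3 := Real.one_sub_inv_le_log_of_pos htq
    have h4 : t * G.toReal ≤ -(1 - (1 - t * q)⁻¹) / d := by
      have : -Real.log (1 - t * q) / d ≤ -(1 - (1 - t * q)⁻¹) / d := by gcongr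
      rw [neg_div] at this
      linarith
    have h5 : -(1 - (1 - t * q)⁻¹) / d = t * (q / d / (1 - t * q)) := by
      field_simp
      ring
    rw [h5] at h4
    have h6 := le_of_mul_le_mul_left h4 ht
    rwa [le_div_iff₀ htq] at h6
  have hcont : Tendsto (fun t : ℝ => 1 - t * q) (𝓝[>] 0) (𝓝 1) := by
    have : Continuous fun t : ℝ => 1 - t * q := by fun_prop
    simpa using (this.tendsto 0).mono_left nhdsWithin_le_nhds
  have hev : ∀ᶠ t in 𝓝[>] (0 : ℝ), G ≠ ∞ ∧ G.toReal * (1 - t * q) ≤ q / d := by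
    filter_upwards [self_mem_nhdsWithin, hcont.eventually_const_lt zero_lt_one] with t ht htq
    exact key t ht htq
  have hGfin : G ≠ ∞ := hev.exists.choose_spec.1
  rw [← ENNReal.ofReal_toReal hGfin]
  refine ENNReal.ofReal_le_ofReal (le_of_tendsto ?_ (hev.mono fun t h => h.2))
  simpa using hcont.const_mul G.toReal

/-- Existence of the angularly sub-isotropic position for a random vector for which no proper
subspace is critical. -/
lemma exists_subisotropic_of_irreducible [IsFiniteMeasure μ] (hD : μ D = μ Set.univ)
    (hY : ∀ ω ∈ D, Y ω ≠ 0) (hd : 0 < d) (hM : μ.real Set.univ ≤ n / d)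
    (hirr : ∀ H : Submodule ℝ (Fin n → ℝ), H ≠ ⊥ → H ≠ ⊤ →
      μ.real Set.univ < μ.real (D ∩ {ω | Y ω ∉ H}) + Module.finrank ℝ H / d) :
    ∃ A : Matrix (Fin n) (Fin n) ℝ, A.IsSymm ∧ (∀ x, x ≠ 0 → 0 < quadForm A x) ∧
      ∀ θ, traceLIntegral μ D
        (fun ω => ENNReal.ofReal ((Y ω ⬝ᵥ A *ᵥ θ) ^ 2 / quadForm A (Y ω))) ≤
          ENNReal.ofReal (quadForm A θ / d) := by
  cases n with
  | zero =>
    refine ⟨1, isSymm_one, fun x hx => absurd (Subsingleton.elim _ _) hx, fun θ => ?_⟩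
    have hμ : μ = 0 := by
      rw [← Measure.measure_univ_eq_zero, ← measureReal_eq_zero_iff]
      refine le_antisymm ?_ measureReal_nonneg
      simpa using hM
    simp [traceLIntegral, hμ]
  | succ m =>
    obtain ⟨A, hA, hmax⟩ := exists_isMax_logPotential hD hY hd hM hirr
    refine ⟨A, hA.1, fun x hx => ?_, traceLIntegral_le_of_isMax hD hY hd hA hmax⟩
    obtain ⟨-, ⟨ε, hε, hlow⟩, -⟩ := hA
    exact lt_of_lt_of_le (mul_pos hε (dotProduct_self_pos hx)) (hlow x)

end LogDeficit

section Gluing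

variable {Ω B : Type*} [MeasurableSpace Ω] [AddCommGroup B] [Module ℝ B] {μ P : Measure Ω}
  {X : Ω → B} {d : ℝ}

/-- The symmetric bilinear form `f` is positive definite on `S`, and the part of `X` in `S` is
angularly sub-isotropic with respect to `f` and `μ`. -/
def IsSubisotropicOn (μ : Measure Ω) (X : Ω → B) (d : ℝ) (S : Submodule ℝ B)
    (f : B →ₗ[ℝ] B →ₗ[ℝ] ℝ) : Prop :=
  (∀ x y, f x y = f y x) ∧ (∀ x ∈ S, x ≠ 0 → 0 < f x x) ∧
    ∀ θ ∈ S, traceLIntegral μ {ω | X ω ∈ S}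
      (fun ω => ENNReal.ofReal ((f (X ω) θ / Real.sqrt (f (X ω) (X ω))) ^ 2)) ≤
        ENNReal.ofReal (f θ θ / d)

open Matrix in
lemma exists_isSubisotropicOn_of_irreducible [FiniteDimensional ℝ B] [IsFiniteMeasure μ]
    {G : Submodule ℝ B} (hG : μ {ω | X ω ∈ G ∧ X ω ≠ 0} = μ Set.univ) (hd : 0 < d)
    (hM : μ.real Set.univ ≤ Module.finrank ℝ G / d)
    (hirr : ∀ G' < G, G' ≠ ⊥ → μ.real Set.univ <
      μ.real ({ω | X ω ∈ G ∧ X ω ≠ 0} ∩ {ω | X ω ∉ G'}) + Module.finrank ℝ G' / d) :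
    ∃ f, IsSubisotropicOn μ X d G f := by
  obtain ⟨π, hπ⟩ := LinearMap.exists_leftInverse_of_injective G.subtype G.ker_subtype
  have hπG : ∀ g : G, π g = g := fun g => LinearMap.congr_fun hπ g
  let e : G ≃ₗ[ℝ] (Fin (Module.finrank ℝ G) → ℝ) := (Module.finBasis ℝ G).equivFun
  let c : B →ₗ[ℝ] (Fin (Module.finrank ℝ G) → ℝ) := e.toLinearMap ∘ₗ π
  have hc : ∀ (x : B) (hx : x ∈ G), c x = e ⟨x, hx⟩ := fun x hx => by
    simp only [c, LinearMap.comp_apply]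
    exact congrArg e (hπG ⟨x, hx⟩)
  have hc0 : ∀ x ∈ G, x ≠ 0 → c x ≠ 0 := fun x hx h0 h => by
    rw [hc x hx] at h
    exact h0 (congrArg Subtype.val (e.map_eq_zero_iff.1 h))
  obtain ⟨A, hsymm, hpos, hA⟩ := exists_subisotropic_of_irreducible (Y := fun ω => c (X ω)) hG
    (fun ω hω => hc0 _ hω.1 hω.2) hd hM (fun H hH hH' => by
      have hmem : ∀ x ∈ G, x ∈ (H.comap e.toLinearMap).map G.subtype ↔ c x ∈ H := by
        intro x hx
        rw [hc x hx]
        constructor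
        · rintro ⟨y, hy, rfl⟩
          exact hy
        · intro h
          exact ⟨⟨x, hx⟩, h, rfl⟩
      have hrank : Module.finrank ℝ ((H.comap e.toLinearMap).map G.subtype) =
          Module.finrank ℝ H := by
        rw [Submodule.finrank_map_subtype_eq, ← e.finrank_map_eq,
          Submodule.map_comap_eq_of_surjective e.surjective]
      have hlt : (H.comap e.toLinearMap).map G.subtype < G := by
        refine lt_of_le_of_ne (Submodule.map_subtype_le _ _) fun h => hH' ?_
        refine Submodule.eq_top_of_finrank_eq ?_
        rw [← hrank, h, Module.finrank_fin_fun]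
      have hne : (H.comap e.toLinearMap).map G.subtype ≠ ⊥ := by
        intro h
        rw [h, finrank_bot] at hrank
        exact hH (Submodule.finrank_eq_zero.1 hrank.symm)
      have := hirr _ hlt hne
      rw [hrank] at this
      refine this.trans_le (add_le_add_left (measureReal_mono ?_) _)
      rintro ω ⟨hω, hω'⟩
      exact ⟨hω, fun h => hω' ((hmem _ hω.1).2 h)⟩)
  refine ⟨(Matrix.toLinearMap₂' ℝ A).compl₁₂ c c, fun x y => ?_, fun x hx h0 => ?_,
    fun θ _ => ?_⟩
  · simp only [LinearMap.compl₁₂_apply, Matrix.toLinearMap₂'_apply']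
    exact dotProduct_mulVec_comm hsymm _ _
  · simp only [LinearMap.compl₁₂_apply, Matrix.toLinearMap₂'_apply']
    exact hpos _ (hc0 x hx h0)
  · simp only [LinearMap.compl₁₂_apply, Matrix.toLinearMap₂'_apply']
    refine (traceLIntegral_mono_set (fun ω hω => hω.1) fun ω hω => ?_).trans (hA (c θ))
    rw [div_pow, ← quadForm, Real.sq_sqrt (hpos _ (hc0 _ hω.1 hω.2)).le]

lemma IsSubisotropicOn.sup [FiniteDimensional ℝ B] {u w : Set Ω} (hw : MeasurableSet w)
    (huw : Disjoint u w) {S G : Submodule ℝ B} (hSG : Disjoint S G) (hd : 0 < d)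
    {f g : B →ₗ[ℝ] B →ₗ[ℝ] ℝ} (hf : IsSubisotropicOn (P.restrict u) X d S f)
    (hg : IsSubisotropicOn (P.restrict w) X d G g) :
    ∃ h, IsSubisotropicOn (P.restrict (u ∪ w)) X d (S ⊔ G) h := by
  obtain ⟨S', hSS', hS'⟩ := hSG.exists_isCompl
  obtain ⟨G', hGG', hG'⟩ := hSG.symm.exists_isCompl
  set p := S'.projection G hS'
  set q := G'.projection S hG'
  have hpS : ∀ x ∈ S, p x = x := fun x hx =>
    Submodule.projection_apply_of_mem_left hS' (hSS' hx)
  have hpG : ∀ x ∈ G, p x = 0 := fun x hx => Submodule.projection_apply_of_mem_right hS' hx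
  have hqG : ∀ x ∈ G, q x = x := fun x hx =>
    Submodule.projection_apply_of_mem_left hG' (hGG' hx)
  have hqS : ∀ x ∈ S, q x = 0 := fun x hx => Submodule.projection_apply_of_mem_right hG' hx
  obtain ⟨hf1, hf2, hf3⟩ := hf
  obtain ⟨hg1, hg2, hg3⟩ := hg
  have hf0 : ∀ x ∈ S, 0 ≤ f x x := fun x hx => by
    by_cases h : x = 0
    · simp [h]
    · exact (hf2 x hx h).le
  have hg0 : ∀ x ∈ G, 0 ≤ g x x := fun x hx => by
    by_cases h : x = 0
    · simp [h]
    · exact (hg2 x hx h).le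
  obtain ⟨h, happ⟩ : ∃ h : B →ₗ[ℝ] B →ₗ[ℝ] ℝ,
      ∀ x y, h x y = f (p x) (p y) + g (q x) (q y) :=
    ⟨f.compl₁₂ p p + g.compl₁₂ q q, fun x y => by simp⟩
  refine ⟨h, fun x y => ?_, fun x hx h0 => ?_, fun θ hθ => ?_⟩
  · rw [happ, happ, hf1, hg1]
  · obtain ⟨s, hs, t, ht, rfl⟩ := Submodule.mem_sup.1 hx
    simp only [happ]
    simp only [map_add, hpS s hs, hpG t ht, hqS s hs, hqG t ht, zero_add, add_zero]
    by_cases h1 : s = 0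
    · exact add_pos_of_nonneg_of_pos (hf0 s hs) (hg2 t ht (by simpa [h1] using h0))
    · exact add_pos_of_pos_of_nonneg (hf2 s hs h1) (hg0 t ht)
  · obtain ⟨s, hs, t, ht, rfl⟩ := Submodule.mem_sup.1 hθ
    rw [traceLIntegral, lintegral_union hw huw]
    have hright : h (s + t) (s + t) / d =
        f s s / d + g t t / d := by
      simp only [happ]
      simp only [map_add, hpS s hs, hpG t ht, hqS s hs, hqG t ht, zero_add, add_zero]
      exact add_div _ _ _
    rw [hright, ENNReal.ofReal_add (div_nonneg (hf0 s hs) hd.le) (div_nonneg (hg0 t ht) hd.le)]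
    refine add_le_add ?_ ?_
    · refine (traceLIntegral_mono_set (D := {ω | X ω ∈ S})
        (fun ω (hω : X ω ∈ S) =>
          show X ω ∈ S ⊔ G from Submodule.mem_sup_left hω) fun ω hω => ?_).trans (hf3 s hs)
      have hω' : X ω ∈ S := hω
      simp only [happ]
      simp only [map_add, hpS s hs, hpG t ht, hqS s hs, hqG t ht, hpS _ hω', hqS _ hω',
        zero_add, add_zero, map_zero, LinearMap.zero_apply]
      exact le_rfl
    · refine (traceLIntegral_mono_set (D := {ω | X ω ∈ G})
        (fun ω (hω : X ω ∈ G) =>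
          show X ω ∈ S ⊔ G from Submodule.mem_sup_right hω) fun ω hω => ?_).trans (hg3 t ht)
      have hω' : X ω ∈ G := hω
      simp only [happ]
      simp only [map_add, hpS s hs, hpG t ht, hqS s hs, hqG t ht, hpG _ hω', hqG _ hω',
        zero_add, add_zero, map_zero, LinearMap.zero_apply]
      exact le_rfl

end Gluing

/-- **Lemma 6.3 (angularly-isotropic position).** Let `X` be a random vector in a
finite-dimensional space `B` with effective rank at least `d ≥ 1`. Then there is a
fixed scalar product `f` on `B` (a symmetric positive-definite bilinear form) such
that, with `|θ| = √(f θ θ)`, one has `E ⟨X/|X|, θ⟩² ≤ |θ|²/d` for all `θ ∈ B`, i.e.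
`E (f(X, θ)/√(f(X, X)))² ≤ f(θ, θ)/d`. -/
theorem exists_angularly_subisotropic_scalar_product
    (d : ℝ) (hd : 1 ≤ d)
    (B : Type) [AddCommGroup B] [Module ℝ B] [FiniteDimensional ℝ B]
    (Ω : Type) (_ : MeasurableSpace Ω) (P : Measure Ω)
    (hP : IsProbabilityMeasure P)
    (X : Ω → B) (hX : EffRankAtLeast P X d) :
    ∃ f : B →ₗ[ℝ] B →ₗ[ℝ] ℝ,
      (∀ x y : B, f x y = f y x) ∧
      (∀ x : B, x ≠ 0 → 0 < f x x) ∧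
      ∀ θ : B,
        ∫⁻ ω, ENNReal.ofReal ((f (X ω) θ / Real.sqrt (f (X ω) (X ω))) ^ 2) ∂P ≤
          ENNReal.ofReal (f θ θ / d) := by
  have hd0 : 0 < d := by linarith
  have hle : ∀ E : Submodule ℝ B, P.real {ω | X ω ∈ E} ≤ Module.finrank ℝ E / d := fun E =>
    ENNReal.toReal_le_of_le_ofReal (by positivity) (hX E).1
  let good : Set (Submodule ℝ B) := {S | ∃ u : Set Ω, MeasurableSet u ∧
    P.real u = Module.finrank ℝ S / d ∧ P.real ({ω | X ω ∈ S} ∩ u) = P.real u ∧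
    ∃ f, IsSubisotropicOn (P.restrict u) X d S f}
  have hbot : (⊥ : Submodule ℝ B) ∈ good := by
    refine ⟨∅, MeasurableSet.empty, by simp, by simp, 0, fun _ _ => rfl, fun x hx h0 => ?_,
      fun θ _ => ?_⟩
    · exact absurd ((Submodule.mem_bot ℝ).1 hx) h0
    · simp [traceLIntegral]
  obtain ⟨S, ⟨u, hu, huS, hSu, f, hf⟩, hmax⟩ :=
    (wellFounded_gt (α := Submodule ℝ B)).has_min good ⟨_, hbot⟩
  have hSsplit := measureReal_inter_add_sdiff (μ := P) (s := {ω | X ω ∈ S}) hu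
  have hSle := hle S
  have hSnull : P.real ({ω | X ω ∈ S} \ u) = 0 :=
    le_antisymm (by linarith) measureReal_nonneg
  have hSeq : P {ω | X ω ∈ S} = ENNReal.ofReal (Module.finrank ℝ S / d) := by
    rw [← ofReal_measureReal]
    congr 1
    linarith
  obtain ⟨F, hSF, hPF⟩ := (hX S).2 hSeq
  have hPF' : P.real {ω | X ω ∈ (S : Set B) ∪ (F : Set B)} = 1 := by
    rw [measureReal_def, hPF, ENNReal.toReal_one]
  have hucompl : P.real uᶜ = 1 - P.real u := probReal_compl_eq_one_sub hu
  have hDfull : P.real ({ω | X ω ∈ F ∧ X ω ≠ 0} ∩ uᶜ) = P.real uᶜ := by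
    refine le_antisymm (measureReal_mono Set.inter_subset_right) ?_
    have h1 : P.real {ω | X ω ∈ (S : Set B) ∪ (F : Set B)} ≤
        P.real (u ∪ ({ω | X ω ∈ S} \ u ∪ ({ω | X ω ∈ F ∧ X ω ≠ 0} ∩ uᶜ))) := by
      refine measureReal_mono fun ω hω => ?_
      by_cases hωu : ω ∈ u
      · exact Or.inl hωu
      · by_cases hωS : X ω ∈ S
        · exact Or.inr (Or.inl ⟨hωS, hωu⟩)
        · refine Or.inr (Or.inr ⟨⟨hω.resolve_left hωS, fun h => hωS ?_⟩, hωu⟩)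
          rw [h]
          exact S.zero_mem
    have h2 := measureReal_union_le (μ := P) u
      ({ω | X ω ∈ S} \ u ∪ ({ω | X ω ∈ F ∧ X ω ≠ 0} ∩ uᶜ))
    have h3 := measureReal_union_le (μ := P) ({ω | X ω ∈ S} \ u)
      ({ω | X ω ∈ F ∧ X ω ≠ 0} ∩ uᶜ)
    linarith
  have hfull : ∀ {w : Set Ω}, MeasurableSet w → ∀ {G : Submodule ℝ B},
      P.real ({ω | X ω ∈ G ∧ X ω ≠ 0} ∩ w) = P.real w →
      P.restrict w {ω | X ω ∈ G ∧ X ω ≠ 0} = P.restrict w Set.univ := fun {w} hw {G} h => by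
    rw [Measure.restrict_apply' hw, Measure.restrict_apply_univ, ← ofReal_measureReal, h,
      ofReal_measureReal]
  by_cases hcrit : ∃ G : Submodule ℝ B, G < F ∧ G ≠ ⊥ ∧
      P.real ({ω | X ω ∈ F ∧ X ω ≠ 0} ∩ {ω | X ω ∉ G} ∩ uᶜ) + Module.finrank ℝ G / d ≤
        P.real uᶜ
  · exfalso
    obtain ⟨G, ⟨hGF, hG0, hGle⟩, hGmin⟩ :=
      (wellFounded_lt (α := Submodule ℝ B)).has_min _ hcrit
    set A := {ω | X ω ∈ F ∧ X ω ≠ 0} ∩ {ω | X ω ∉ G} ∩ uᶜ with hA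
    set v := toMeasurable P A ∩ uᶜ with hv
    have hvm : MeasurableSet v := (measurableSet_toMeasurable _ _).inter hu.compl
    have hAv : A ⊆ v := Set.subset_inter (subset_toMeasurable _ _) Set.inter_subset_right
    have hPv : P.real v = P.real A := by
      refine le_antisymm ((measureReal_mono Set.inter_subset_left).trans_eq ?_)
        (measureReal_mono hAv)
      rw [measureReal_def, measure_toMeasurable, ← measureReal_def]
    set w := uᶜ \ v with hw
    have hwm : MeasurableSet w := hu.compl.diff hvm
    have hPw : P.real w = P.real uᶜ - P.real v := measureReal_sdiff Set.inter_subset_right hvm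
    have hsplit : ∀ T : Set Ω, P.real (T ∩ uᶜ) ≤ P.real v + P.real (T ∩ w) := fun T => by
      refine (measureReal_mono fun ω hω => ?_).trans (measureReal_union_le v (T ∩ w))
      by_cases h : ω ∈ v
      · exact Or.inl h
      · exact Or.inr ⟨hω.1, hω.2, h⟩
    have hDG : ∀ ω ∈ w, X ω ∈ F ∧ X ω ≠ 0 → X ω ∈ G ∧ X ω ≠ 0 := fun ω hω hF =>
      ⟨by_contra fun h => hω.2 (hAv ⟨⟨hF, h⟩, hω.1⟩), hF.2⟩
    have hGfull : P.real ({ω | X ω ∈ G ∧ X ω ≠ 0} ∩ w) = P.real w := by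
      refine le_antisymm (measureReal_mono Set.inter_subset_right) ?_
      have h1 := hsplit {ω | X ω ∈ F ∧ X ω ≠ 0}
      have h2 : P.real ({ω | X ω ∈ F ∧ X ω ≠ 0} ∩ w) ≤
          P.real ({ω | X ω ∈ G ∧ X ω ≠ 0} ∩ w) :=
        measureReal_mono fun ω hω => ⟨hDG ω hω.2 hω.1, hω.2⟩
      linarith
    have hPwG : P.real w = Module.finrank ℝ G / d := by
      refine le_antisymm ?_ (by linarith)
      rw [← hGfull]
      exact (measureReal_mono fun ω hω => hω.1.1).trans (hle G)
    obtain ⟨g, hg⟩ := exists_isSubisotropicOn_of_irreducible (μ := P.restrict w) (X := X)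
      (hfull hwm hGfull) hd0 (by rw [measureReal_restrict_apply_univ, hPwG])
      (fun G' hG' hG'0 => by
        rw [measureReal_restrict_apply_univ, measureReal_restrict_apply' hwm]
        have h1 : ¬ (P.real ({ω | X ω ∈ F ∧ X ω ≠ 0} ∩ {ω | X ω ∉ G'} ∩ uᶜ) +
            Module.finrank ℝ G' / d ≤ P.real uᶜ) := fun h =>
          hGmin G' ⟨hG'.trans hGF, hG'0, h⟩ hG'
        have h2 := hsplit ({ω | X ω ∈ F ∧ X ω ≠ 0} ∩ {ω | X ω ∉ G'})
        have h3 : P.real ({ω | X ω ∈ F ∧ X ω ≠ 0} ∩ {ω | X ω ∉ G'} ∩ w) ≤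
            P.real ({ω | X ω ∈ G ∧ X ω ≠ 0} ∩ {ω | X ω ∉ G'} ∩ w) :=
          measureReal_mono fun ω hω => ⟨⟨hDG ω hω.2 hω.1.1, hω.1.2⟩, hω.2⟩
        rw [not_le] at h1
        linarith)
    have hdisj : Disjoint S G := hSF.disjoint.mono_right hGF.le
    have huw : Disjoint u w := Set.disjoint_left.2 fun ω h1 h2 => h2.1 h1
    obtain ⟨h, hh⟩ := hf.sup hwm huw hdisj hd0 hg
    have hPuw : P.real (u ∪ w) = P.real u + P.real w := measureReal_union huw hwm
    refine hmax (S ⊔ G) ⟨u ∪ w, hu.union hwm, ?_, ?_, h, hh⟩ ?_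
    · have hrank := Submodule.finrank_sup_add_finrank_inf_eq S G
      rw [hdisj.eq_bot, finrank_bot, add_zero] at hrank
      rw [hPuw, huS, hPwG, hrank]
      push_cast
      ring
    · refine le_antisymm (measureReal_mono Set.inter_subset_right) ?_
      have h1 := measureReal_inter_add_sdiff (μ := P) (s := {ω | X ω ∈ S ⊔ G} ∩ (u ∪ w)) hu
      have h2 : P.real ({ω | X ω ∈ S} ∩ u) ≤
          P.real ({ω | X ω ∈ S ⊔ G} ∩ (u ∪ w) ∩ u) :=
        measureReal_mono fun ω hω => ⟨⟨Submodule.mem_sup_left hω.1, Or.inl hω.2⟩, hω.2⟩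
      have h3 : P.real ({ω | X ω ∈ G ∧ X ω ≠ 0} ∩ w) ≤
          P.real (({ω | X ω ∈ S ⊔ G} ∩ (u ∪ w)) \ u) :=
        measureReal_mono fun ω hω =>
          ⟨⟨Submodule.mem_sup_right hω.1.1, Or.inr hω.2⟩, hω.2.1⟩
      linarith
    · refine lt_of_le_of_ne le_sup_left fun h => hG0 ?_
      have h1 : G ≤ S := h ▸ le_sup_right
      exact hdisj.symm.eq_bot_of_le h1
  · push Not at hcrit
    have hFdim : P.real uᶜ ≤ Module.finrank ℝ F / d := by
      have h1 := hle ⊤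
      have h2 : P.real {ω | X ω ∈ (⊤ : Submodule ℝ B)} = 1 := by simp
      rw [h2, finrank_top, ← Submodule.finrank_add_eq_of_isCompl hSF] at h1
      push_cast at h1
      rw [add_div] at h1
      linarith
    obtain ⟨g, hg⟩ := exists_isSubisotropicOn_of_irreducible (μ := P.restrict uᶜ) (X := X)
      (hfull hu.compl hDfull) hd0 (by rwa [measureReal_restrict_apply_univ])
      (fun G' hG' hG'0 => by
        rw [measureReal_restrict_apply_univ, measureReal_restrict_apply' hu.compl]
        exact hcrit G' hG' hG'0)
    obtain ⟨h, hsymm, hpos, hh⟩ := hf.sup hu.compl disjoint_compl_right hSF.disjoint hd0 hg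
    rw [hSF.sup_eq_top] at hpos hh
    refine ⟨h, hsymm, fun x hx => hpos x Submodule.mem_top hx, fun θ => ?_⟩
    simpa [traceLIntegral] using hh θ Submodule.mem_top
end
end
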